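/- arXiv:1411.4819 — 3 statements merged into one kernel-verified Lean document; each statement's English description precedes it below -/
import Mathlib

section
/- Let G be a 2-connected graph that admits an open ear decomposition with l ears, and let s and t be two distinct vertices of G. Then G contains at least l+1 distinct s-t-paths. -/
open SimpleGraph

variable {V : Type*}

/-- A graph is `k`-connected if it has more than `k` vertices and no set of fewer than `k`
vertices whose deletion leaves a disconnected graph. -/
def IsKConnected [Fintype V] (k : ℕ) (G : SimpleGraph V) : Prop :=
  k < Fintype.card V ∧
    ∀ S : Finset V, S.card < k → (G.induce ((↑S : Set V)ᶜ)).Connected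

/-- `H` is a subgraph of `G` that is a cycle. -/
def IsCycleSubgraph {G : SimpleGraph V} (H : G.Subgraph) : Prop :=
  ∃ (u : V) (c : G.Walk u u), c.IsCycle ∧ H = c.toSubgraph

/-- `H` is a subgraph of `G` that is a path with endpoints `s` and `t`. -/
def IsPathSubgraph {G : SimpleGraph V} (H : G.Subgraph) (s t : V) : Prop :=
  ∃ p : G.Walk s t, p.IsPath ∧ H = p.toSubgraph

/-- `P` is an open ear decomposition of `G` with `l` ears: the edge sets of the `P i`
partition the edge set of `G`, `P 0` is a cycle, and every later `P i` is a path that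
intersects the union of the previous ears in exactly its two (distinct) endpoints. -/
def IsOpenEarDecomposition {G : SimpleGraph V} {l : ℕ} (P : Fin l → G.Subgraph) : Prop :=
  ∃ hl : 0 < l,
    (∀ e, e ∈ G.edgeSet ↔ ∃ i, e ∈ (P i).edgeSet) ∧
    (∀ i j, i ≠ j → Disjoint (P i).edgeSet (P j).edgeSet) ∧
    IsCycleSubgraph (P ⟨0, hl⟩) ∧
    ∀ i : Fin l, 0 < i.val →
      ∃ a b : V, a ≠ b ∧ IsPathSubgraph (P i) a b ∧
        (P i).verts ∩ (⨆ j : {j : Fin l // j < i}, (P j.1).verts) = {a, b}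

/-- The subgraphs of `H` that are paths from `s` to `t`. -/
def pathsIn {G : SimpleGraph V} (H : G.Subgraph) (s t : V) : Set G.Subgraph :=
  {Q | Q ≤ H ∧ IsPathSubgraph Q s t}

/-- Any two vertices of `H` are joined by a walk in `H` avoiding any given other vertex. -/
def HasNoCutVertex {G : SimpleGraph V} (H : G.Subgraph) : Prop :=
  ∀ v s t, s ∈ H.verts → t ∈ H.verts → s ≠ v → t ≠ v →
    ∃ p : G.Walk s t, p.toSubgraph ≤ H ∧ v ∉ p.support

/-- There are disjoint walks in `H` from `s` to `a` and from `t` to `b`. -/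
def Linked {G : SimpleGraph V} (H : G.Subgraph) (s t a b : V) : Prop :=
  ∃ (p : G.Walk s a) (q : G.Walk t b), p.toSubgraph ≤ H ∧ q.toSubgraph ≤ H ∧
    ∀ x ∈ p.support, x ∉ q.support

/-- The path `p` is an open ear that can be attached to `H`. -/
structure IsEar {G : SimpleGraph V} (H : G.Subgraph) {a b : V} (p : G.Walk a b) : Prop where
  isPath : p.IsPath
  ne : a ≠ b
  left_mem : a ∈ H.verts
  right_mem : b ∈ H.verts
  eq_or_eq : ∀ x ∈ p.support, x ∈ H.verts → x = a ∨ x = b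
  not_adj : ∀ x y, p.toSubgraph.Adj x y → ¬ H.Adj x y

section

variable {G : SimpleGraph V} {H H' : G.Subgraph} {s t a b u v w x y : V}

theorem IsEar.reverse {p : G.Walk a b} (hp : IsEar H p) : IsEar H p.reverse where
  isPath := hp.isPath.reverse
  ne := hp.ne.symm
  left_mem := hp.right_mem
  right_mem := hp.left_mem
  eq_or_eq x hx hxH := (hp.eq_or_eq x (by simpa using hx) hxH).symm
  not_adj x y hxy := hp.not_adj x y (by simpa using hxy)

theorem mem_verts_of_mem_support {p : G.Walk u v} (hp : p.toSubgraph ≤ H) (hx : x ∈ p.support) :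
    x ∈ H.verts :=
  Subgraph.verts_mono hp (p.mem_verts_toSubgraph.2 hx)

theorem isPath_append_of_eq {p : G.Walk u v} {q : G.Walk v w} (hp : p.IsPath) (hq : q.IsPath)
    (h : ∀ x ∈ p.support, x ∈ q.support → x = v) : (p.append q).IsPath := by
  rw [Walk.isPath_def, Walk.support_append, List.nodup_append']
  refine ⟨hp.support_nodup, hq.support_nodup.tail, fun x hx hx' => ?_⟩
  have := h x hx (List.mem_of_mem_tail hx')
  subst this
  have hn := hq.support_nodup
  rw [← Walk.cons_tail_support] at hn
  exact (List.nodup_cons.1 hn).1 hx'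

theorem eq_of_mem_support_of_isPath_append {p : G.Walk u v} {q : G.Walk v w}
    (h : (p.append q).IsPath) (hp : x ∈ p.support) (hq : x ∈ q.support) : x = v := by
  by_contra hxv
  exact h.ne_of_mem_support_of_append hxv hp hq rfl

theorem exists_isPath_of_walk (p : G.Walk u v) :
    ∃ q : G.Walk u v, q.IsPath ∧ q.toSubgraph ≤ p.toSubgraph ∧ q.support ⊆ p.support := by
  classical
  exact ⟨p.bypass, p.bypass_isPath, Walk.toSubgraph_bypass_le_toSubgraph,
    p.support_bypass_subset_support⟩

theorem exists_walk_to_first (S : Set V) (p : G.Walk u v) (hv : v ∈ S) :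
    ∃ z ∈ S, ∃ q : G.Walk u z, q.toSubgraph ≤ p.toSubgraph ∧ q.support ⊆ p.support ∧
      ∀ x ∈ q.support, x ∈ S → x = z := by
  induction p with
  | nil => exact ⟨_, hv, .nil, le_rfl, fun _ h => h, by simp⟩
  | @cons u w v h p ih =>
    by_cases hu : u ∈ S
    · refine ⟨u, hu, .nil, ?_, by simp, by simp⟩
      simp [Walk.toSubgraph]
    · obtain ⟨z, hz, q, hq, hqs, hqS⟩ := ih hv
      refine ⟨z, hz, .cons h q, ?_, ?_, ?_⟩
      · exact sup_le_sup le_rfl hq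
      · simp only [Walk.support_cons]
        exact List.cons_subset_cons _ hqs
      · intro x hx hxS
        rcases List.mem_cons.1 (by simpa using hx) with rfl | hx
        · exact absurd hxS hu
        · exact hqS x hx hxS

theorem Linked.symm (h : Linked H s t a b) : Linked H t s b a := by
  obtain ⟨p, q, hp, hq, hpq⟩ := h
  exact ⟨q, p, hq, hp, fun x hx hx' => hpq x hx' hx⟩

theorem toSubgraph_cons_le {h : G.Adj u v} {p : G.Walk v w} (huv : H.Adj u v)
    (hp : p.toSubgraph ≤ H) : (Walk.cons h p).toSubgraph ≤ H :=
  sup_le (subgraphOfAdj_le_of_adj H huv) hp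

theorem Linked.step (hH : HasNoCutVertex H) (h : Linked H s t a b) (hs : H.Adj s v)
    (hvt : v ≠ t) : Linked H v t a b ∨ Linked H v t b a := by
  obtain ⟨p, q, hp, hq, hpq⟩ := h
  obtain ⟨q, hqP, hqq, hqs⟩ : ∃ q' : G.Walk t b, q'.IsPath ∧ q'.toSubgraph ≤ H ∧
      ∀ x ∈ p.support, x ∉ q'.support := by
    obtain ⟨q', h1, h2, h3⟩ := exists_isPath_of_walk q
    exact ⟨q', h1, h2.trans hq, fun x hx hx' => hpq x hx (h3 hx')⟩
  by_cases hvq : v ∈ q.support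
  · have hvp : v ∉ p.support := fun h => hqs v h hvq
    have hav : a ≠ v := fun h => hvp (h ▸ p.end_mem_support)
    obtain ⟨Q, hQ, hvQ⟩ := hH v t a (mem_verts_of_mem_support hqq q.start_mem_support)
      (mem_verts_of_mem_support hp p.end_mem_support) hvt.symm hav
    obtain ⟨q₁, q₂, hq₁₂⟩ := Walk.mem_support_iff_exists_append.1 hvq
    subst hq₁₂
    rw [Walk.toSubgraph_append, sup_le_iff] at hqq
    simp only [Walk.mem_support_append_iff] at hqs
    obtain ⟨z, hz, r, hr, hrs, hrz⟩ := exists_walk_to_first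
      {x | x ∈ p.support ∨ x ∈ q₂.support} Q (Or.inl p.end_mem_support)
    have hvr : v ∉ r.support := fun h => hvQ (hrs h)
    rcases hz with hz | hz
    · right
      obtain ⟨p₁, p₂, rfl⟩ := Walk.mem_support_iff_exists_append.1 hz
      rw [Walk.toSubgraph_append, sup_le_iff] at hp
      refine ⟨q₂, r.append p₂, hqq.2, ?_, ?_⟩
      · rw [Walk.toSubgraph_append]
        exact sup_le (hr.trans hQ) hp.2
      · intro x hx hx'
        rcases (Walk.mem_support_append_iff _ _).1 hx' with hx' | hx'
        · obtain rfl := hrz x hx' (Or.inr hx)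
          exact hqs x hz (Or.inr hx)
        · exact hqs x ((Walk.mem_support_append_iff _ _).2 (Or.inr hx')) (Or.inr hx)
    · left
      obtain ⟨q₃, q₄, rfl⟩ := Walk.mem_support_iff_exists_append.1 hz
      rw [Walk.toSubgraph_append, sup_le_iff] at hqq
      refine ⟨.cons (H.adj_sub hs.symm) p, r.append q₄, toSubgraph_cons_le hs.symm hp, ?_, ?_⟩
      · rw [Walk.toSubgraph_append]
        exact sup_le (hr.trans hQ) hqq.2.2
      · intro x hx hx'
        rcases List.mem_cons.1 (by simpa using hx) with rfl | hx
        · rcases (Walk.mem_support_append_iff _ _).1 hx' with hx' | hx'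
          · exact hvr hx'
          · have := eq_of_mem_support_of_isPath_append hqP.of_append_right
              q₃.start_mem_support hx'
            subst this
            exact hvr r.end_mem_support
        · rcases (Walk.mem_support_append_iff _ _).1 hx' with hx' | hx'
          · obtain rfl := hrz x hx' (Or.inl hx)
            exact hqs x hx (Or.inr hz)
          · exact hqs x hx (Or.inr ((Walk.mem_support_append_iff _ _).2 (Or.inr hx')))
  · left
    refine ⟨.cons (H.adj_sub hs.symm) p, q, toSubgraph_cons_le hs.symm hp, hqq, fun x hx => ?_⟩
    rcases List.mem_cons.1 (by simpa using hx) with rfl | hx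
    · exact hvq
    · exact hqs x hx

theorem linked_of_walk (hH : HasNoCutVertex H) (p : G.Walk u v) (hp : p.toSubgraph ≤ H)
    (ht : t ∉ p.support) (h : Linked H u t a b ∨ Linked H u t b a) :
    Linked H v t a b ∨ Linked H v t b a := by
  induction p with
  | nil => exact h
  | @cons u w v huw p ih =>
    have hadj : H.Adj u w := hp.2 (by simp [Walk.toSubgraph])
    rw [Walk.support_cons, List.mem_cons, not_or] at ht
    have hwt : w ≠ t := fun h => ht.2 (h ▸ p.start_mem_support)
    refine ih (le_trans le_sup_right hp) ht.2 ?_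
    rcases h with h | h
    · exact h.step hH hadj hwt
    · exact (h.step hH hadj hwt).symm

theorem HasNoCutVertex.linked (hH : HasNoCutVertex H) (hs : s ∈ H.verts) (ht : t ∈ H.verts)
    (ha : a ∈ H.verts) (hb : b ∈ H.verts) (hst : s ≠ t) (hab : a ≠ b) :
    Linked H s t a b ∨ Linked H s t b a := by
  have h₀ : Linked H a b a b := by
    refine ⟨.nil, .nil, ?_, ?_, by simpa using hab⟩ <;> simpa [Walk.toSubgraph]
  have hsymm : ∀ {u v}, Linked H u v a b ∨ Linked H u v b a →
      Linked H v u a b ∨ Linked H v u b a := fun h => (h.imp Linked.symm Linked.symm).symm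
  by_cases hsb : s = b
  · subst hsb
    obtain ⟨p, hp, hp'⟩ := hH s a t ha ht hab hst.symm
    exact hsymm (linked_of_walk hH p hp hp' (Or.inl h₀))
  · obtain ⟨p, hp, hp'⟩ := hH b a s ha hs hab hsb
    obtain ⟨q, hq, hq'⟩ := hH s b t hb ht (Ne.symm hsb) hst.symm
    exact hsymm (linked_of_walk hH q hq hq'
      (hsymm (linked_of_walk hH p hp hp' (Or.inl h₀))))

theorem exists_mem_pathsIn_of_linked {p : G.Walk a b} (hp : IsEar H p)
    (h : Linked H s t a b) :
    ∃ Q ∈ pathsIn (H ⊔ p.toSubgraph) s t, p.toSubgraph ≤ Q := by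
  obtain ⟨q, r, hq, hr, hqr⟩ := h
  obtain ⟨q, hqP, hq, hqs⟩ : ∃ q' : G.Walk s a, q'.IsPath ∧ q'.toSubgraph ≤ H ∧
      ∀ x ∈ q'.support, x ∉ r.support := by
    obtain ⟨q', h1, h2, h3⟩ := exists_isPath_of_walk q
    exact ⟨q', h1, h2.trans hq, fun x hx => hqr x (h3 hx)⟩
  obtain ⟨r, hrP, hr, hrs⟩ : ∃ r' : G.Walk t b, r'.IsPath ∧ r'.toSubgraph ≤ H ∧
      ∀ x ∈ q.support, x ∉ r'.support := by
    obtain ⟨q', h1, h2, h3⟩ := exists_isPath_of_walk r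
    exact ⟨q', h1, h2.trans hr, fun x hx hx' => hqs x hx (h3 hx')⟩
  refine ⟨((q.append p).append r.reverse).toSubgraph, ⟨?_, _, ?_, rfl⟩, ?_⟩
  · simp only [Walk.toSubgraph_append, Walk.toSubgraph_reverse]
    exact sup_le (sup_le (hq.trans le_sup_left) le_sup_right) (hr.trans le_sup_left)
  · refine isPath_append_of_eq (isPath_append_of_eq hqP hp.isPath ?_) hrP.reverse ?_
    · intro x hx hx'
      refine (hp.eq_or_eq x hx' (mem_verts_of_mem_support hq hx)).resolve_right ?_
      rintro rfl
      exact hrs _ hx r.end_mem_support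
    · intro x hx hx'
      rw [Walk.support_reverse, List.mem_reverse] at hx'
      rcases (Walk.mem_support_append_iff _ _).1 hx with hx | hx
      · exact absurd hx' (hrs x hx)
      · refine (hp.eq_or_eq x hx (mem_verts_of_mem_support hr hx')).resolve_left ?_
        rintro rfl
        exact hrs _ q.end_mem_support hx'
  · simp only [Walk.toSubgraph_append]
    exact le_trans le_sup_right le_sup_left

theorem pathsIn_comm : pathsIn H s t = pathsIn H t s := by
  ext Q
  constructor <;>
  · rintro ⟨h, p, hp, rfl⟩
    exact ⟨h, p.reverse, hp.reverse, by simp⟩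

theorem ncard_add_one_le_of_sup [Finite V] {A B : Set G.Subgraph} {R Z : G.Subgraph}
    (hA : ∀ E ∈ A, E ≤ H ∧ R ⊓ H ≤ E) (hB : ∀ E ∈ A, E ⊔ R ∈ B) (hZ : Z ∈ B)
    (hZA : ∀ E ∈ A, E ⊔ R ≠ Z) : A.ncard + 1 ≤ B.ncard := by
  have hinj : Set.InjOn (· ⊔ R) A := by
    have key : ∀ E ∈ A, (E ⊔ R) ⊓ H = E := fun E hE => by
      rw [inf_sup_right, inf_eq_left.2 (hA E hE).1, sup_eq_left.2 (hA E hE).2]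
    intro E hE F hF h
    rw [← key E hE, ← key F hF]
    exact congrArg (· ⊓ H) h
  have hnot : Z ∉ (· ⊔ R) '' A := by
    rintro ⟨E, hE, h⟩
    exact hZA E hE h
  rw [← hinj.ncard_image, ← Set.ncard_insert_of_notMem hnot (Set.toFinite _)]
  refine Set.ncard_le_ncard ?_ (Set.toFinite _)
  rintro _ (rfl | ⟨E, hE, rfl⟩)
  · exact hZ
  · exact hB E hE

theorem exists_adj_start (p : G.Walk u v) (h : u ≠ v) : ∃ w, p.toSubgraph.Adj u w :=
  ⟨p.snd, p.toSubgraph_adj_snd fun hn => h hn.eq⟩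

theorem ncard_pathsIn_of_mem_of_mem [Finite V] (hH : HasNoCutVertex H) {p : G.Walk a b}
    (hp : IsEar H p) (hs : s ∈ H.verts) (ht : t ∈ H.verts) (hst : s ≠ t) :
    (pathsIn H s t).ncard + 1 ≤ (pathsIn (H ⊔ p.toSubgraph) s t).ncard := by
  obtain ⟨Q, hQ, hpQ⟩ : ∃ Q ∈ pathsIn (H ⊔ p.toSubgraph) s t, p.toSubgraph ≤ Q := by
    rcases hH.linked hs ht hp.left_mem hp.right_mem hst hp.ne with h | h
    · exact exists_mem_pathsIn_of_linked hp h
    · simpa using exists_mem_pathsIn_of_linked hp.reverse h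
  refine ncard_add_one_le_of_sup (H := H) (R := ⊥) (Z := Q) ?_ ?_ hQ ?_
  · exact fun E hE => ⟨hE.1, by simp⟩
  · exact fun E hE => ⟨by simpa using hE.1.trans le_sup_left, by simpa using hE.2⟩
  · rintro E hE rfl
    obtain ⟨w, hw⟩ := exists_adj_start p hp.ne
    exact hp.not_adj a w hw (hE.1.2 (by simpa using hpQ.2 hw))

theorem ncard_pathsIn_of_mem_of_ne [Finite V] {n : ℕ} (hH : HasNoCutVertex H)
    (hn : ∀ s ∈ H.verts, ∀ t ∈ H.verts, s ≠ t → n ≤ (pathsIn H s t).ncard) {p : G.Walk a b}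
    (hp : IsEar H p) (hs : s ∈ H.verts) (ht : t ∉ H.verts) (htp : t ∈ p.support) (hsa : s ≠ a) :
    n + 1 ≤ (pathsIn (H ⊔ p.toSubgraph) s t).ncard := by
  obtain ⟨e, f, rfl⟩ := Walk.mem_support_iff_exists_append.1 htp
  have hat : a ≠ t := fun h => ht (h ▸ hp.left_mem)
  have hbt : b ≠ t := fun h => ht (h ▸ hp.right_mem)
  have hst : s ≠ t := fun h => ht (h ▸ hs)
  have hmid : ∀ {x}, x ∈ e.support → x ∈ f.support → x = t :=
    fun h h' => eq_of_mem_support_of_isPath_append hp.isPath h h'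
  have heH : ∀ {x}, x ∈ e.support → x ∈ H.verts → x = a := fun h h' =>
    (hp.eq_or_eq _ ((Walk.mem_support_append_iff _ _).2 (Or.inl h)) h').resolve_right
      fun hxb => hbt (hmid (hxb ▸ h) f.end_mem_support)
  have hfH : ∀ {x}, x ∈ f.support → x ∈ H.verts → x = b := fun h h' =>
    (hp.eq_or_eq _ ((Walk.mem_support_append_iff _ _).2 (Or.inr h)) h').resolve_left
      fun hxa => hat (hmid e.start_mem_support (hxa ▸ h))
  have hadj : ∀ {x y}, e.toSubgraph.Adj x y → ¬ H.Adj x y := fun h =>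
    hp.not_adj _ _ (by rw [Walk.toSubgraph_append, Subgraph.sup_adj]; exact Or.inl h)
  obtain ⟨q, hq, -⟩ := hH t s b hs hp.right_mem hst hbt
  obtain ⟨r, hrP, hr, -⟩ := exists_isPath_of_walk q
  replace hr := hr.trans hq
  refine (Nat.add_le_add_right (hn s hs a hp.left_mem hsa) 1).trans
    (ncard_add_one_le_of_sup (H := H) (R := e.toSubgraph)
      (Z := (r.append f.reverse).toSubgraph) ?_ ?_ ⟨?_, _, ?_, rfl⟩ ?_)
  · rintro _ ⟨hE, g, hg, rfl⟩
    refine ⟨hE, ?_, ?_⟩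
    · rintro x ⟨hx, hxH⟩
      rw [heH (e.mem_verts_toSubgraph.1 hx) hxH]
      exact g.end_mem_verts_toSubgraph
    · rintro x y ⟨hx, hxH⟩
      exact absurd hxH (hadj hx)
  · rintro _ ⟨hE, g, hg, rfl⟩
    refine ⟨?_, g.append e, ?_, by simp⟩
    · rw [Walk.toSubgraph_append]
      exact sup_le_sup hE le_sup_left
    · exact isPath_append_of_eq hg hp.isPath.of_append_left
        fun x hx hx' => heH hx' (mem_verts_of_mem_support hE hx)
  · simp only [Walk.toSubgraph_append, Walk.toSubgraph_reverse]
    exact sup_le_sup hr le_sup_right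
  · refine isPath_append_of_eq hrP hp.isPath.of_append_right.reverse fun x hx hx' => ?_
    exact hfH (by simpa using hx') (mem_verts_of_mem_support hr hx)
  · intro E hE h
    obtain ⟨w, hw⟩ := exists_adj_start e hat
    have hw' : (r.append f.reverse).toSubgraph.Adj a w := by
      rw [← h]
      exact Or.inr hw
    simp only [Walk.toSubgraph_append, Walk.toSubgraph_reverse, Subgraph.sup_adj] at hw'
    rcases hw' with hw' | hw'
    · exact hadj hw (hr.2 hw')
    · exact hat (hmid e.start_mem_support (Walk.mem_support_of_adj_toSubgraph hw'))

theorem ncard_pathsIn_of_mem [Finite V] {n : ℕ} (hH : HasNoCutVertex H)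
    (hn : ∀ s ∈ H.verts, ∀ t ∈ H.verts, s ≠ t → n ≤ (pathsIn H s t).ncard) {p : G.Walk a b}
    (hp : IsEar H p) (hs : s ∈ H.verts) (ht : t ∉ H.verts) (htp : t ∈ p.support) :
    n + 1 ≤ (pathsIn (H ⊔ p.toSubgraph) s t).ncard := by
  by_cases hsa : s = a
  · simpa using ncard_pathsIn_of_mem_of_ne hH hn hp.reverse hs ht (by simpa using htp)
      (hsa ▸ hp.ne)
  · exact ncard_pathsIn_of_mem_of_ne hH hn hp hs ht htp hsa

theorem ncard_pathsIn_of_append [Finite V] {n : ℕ}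
    (hn : ∀ s ∈ H.verts, ∀ t ∈ H.verts, s ≠ t → n ≤ (pathsIn H s t).ncard)
    {e : G.Walk a s} {m : G.Walk s t} {f : G.Walk t b}
    (hp : IsEar H (e.append (m.append f))) (hs : s ∉ H.verts) (ht : t ∉ H.verts) (hst : s ≠ t) :
    n + 1 ≤ (pathsIn (H ⊔ (e.append (m.append f)).toSubgraph) s t).ncard := by
  have hPmf := hp.isPath.of_append_right
  have has : a ≠ s := fun h => hs (h ▸ hp.left_mem)
  have hbt : b ≠ t := fun h => ht (h ▸ hp.right_mem)
  have h₁ : ∀ {x}, x ∈ e.support → x ∈ m.support ∨ x ∈ f.support → x = s :=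
    fun h h' => eq_of_mem_support_of_isPath_append hp.isPath h
      ((Walk.mem_support_append_iff _ _).2 h')
  have h₂ : ∀ {x}, x ∈ m.support → x ∈ f.support → x = t :=
    fun h h' => eq_of_mem_support_of_isPath_append hPmf h h'
  have hef : ∀ {x}, x ∈ e.support → x ∉ f.support := fun h h' => by
    obtain rfl := h₁ h (Or.inr h')
    exact hst (h₂ m.start_mem_support h')
  have hH : ∀ {x}, x ∈ e.support ∨ x ∈ f.support → x ∈ H.verts → x = a ∨ x = b := fun h =>
    hp.eq_or_eq _ (by simp only [Walk.mem_support_append_iff]; tauto)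
  have heH : ∀ {x}, x ∈ e.support → x ∈ H.verts → x = a := fun h h' =>
    (hH (Or.inl h) h').resolve_right fun hxb => hef (hxb ▸ h) f.end_mem_support
  have hfH : ∀ {x}, x ∈ f.support → x ∈ H.verts → x = b := fun h h' =>
    (hH (Or.inr h) h').resolve_left fun hxa => hef e.start_mem_support (hxa ▸ h)
  refine (Nat.add_le_add_right (hn a hp.left_mem b hp.right_mem hp.ne) 1).trans
    (ncard_add_one_le_of_sup (H := H) (R := e.toSubgraph ⊔ f.toSubgraph)
      (Z := m.toSubgraph) ?_ ?_ ⟨?_, _, hPmf.of_append_left, rfl⟩ ?_)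
  · rintro _ ⟨hE, g, hg, rfl⟩
    refine ⟨hE, ?_, ?_⟩
    · rintro x ⟨hx | hx, hxH⟩
      · rw [heH (e.mem_verts_toSubgraph.1 hx) hxH]
        exact g.start_mem_verts_toSubgraph
      · rw [hfH (f.mem_verts_toSubgraph.1 hx) hxH]
        exact g.end_mem_verts_toSubgraph
    · rintro x y ⟨hx, hxH⟩
      refine absurd hxH (hp.not_adj x y ?_)
      simp only [Walk.toSubgraph_append, Subgraph.sup_adj] at hx ⊢
      tauto
  · rintro _ ⟨hE, g, hg, rfl⟩
    refine ⟨?_, (e.reverse.append g).append f.reverse, ?_, ?_⟩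
    · simp only [Walk.toSubgraph_append]
      refine sup_le_sup hE (sup_le_sup le_rfl le_sup_right)
    · refine isPath_append_of_eq (isPath_append_of_eq hp.isPath.of_append_left.reverse hg ?_)
        hPmf.of_append_right.reverse ?_
      · exact fun x hx hx' => heH (by simpa using hx) (mem_verts_of_mem_support hE hx')
      · intro x hx hx'
        rw [Walk.support_reverse, List.mem_reverse] at hx'
        rcases (Walk.mem_support_append_iff _ _).1 hx with hx | hx
        · exact absurd hx' (hef (by simpa using hx))
        · exact hfH hx' (mem_verts_of_mem_support hE hx)
    · simp only [Walk.toSubgraph_append, Walk.toSubgraph_reverse]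
      rw [← sup_assoc, sup_comm g.toSubgraph]
  · simp only [Walk.toSubgraph_append]
    exact le_trans (le_trans le_sup_left le_sup_right) le_sup_right
  · intro E hE h
    have ha : a ∈ m.toSubgraph.verts := by
      rw [← h]
      exact Or.inr (Or.inl e.start_mem_verts_toSubgraph)
    exact has (h₁ e.start_mem_support (Or.inl (m.mem_verts_toSubgraph.1 ha)))

theorem IsEar.add_one_le_ncard_pathsIn [Finite V] {n : ℕ} (hH : HasNoCutVertex H)
    (hn : ∀ s ∈ H.verts, ∀ t ∈ H.verts, s ≠ t → n ≤ (pathsIn H s t).ncard) {p : G.Walk a b}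
    (hp : IsEar H p) (hs : s ∈ (H ⊔ p.toSubgraph).verts) (ht : t ∈ (H ⊔ p.toSubgraph).verts)
    (hst : s ≠ t) : n + 1 ≤ (pathsIn (H ⊔ p.toSubgraph) s t).ncard := by
  rw [Subgraph.verts_sup, Set.mem_union, Walk.mem_verts_toSubgraph] at hs ht
  by_cases hsH : s ∈ H.verts <;> by_cases htH : t ∈ H.verts
  · exact (Nat.add_le_add_right (hn s hsH t htH hst) 1).trans
      (ncard_pathsIn_of_mem_of_mem hH hp hsH htH hst)
  · exact ncard_pathsIn_of_mem hH hn hp hsH htH (ht.resolve_left htH)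
  · rw [pathsIn_comm]
    exact ncard_pathsIn_of_mem hH hn hp htH hsH (hs.resolve_left hsH)
  · obtain ⟨e, f, rfl⟩ := Walk.mem_support_iff_exists_append.1 (hs.resolve_left hsH)
    rcases (Walk.mem_support_append_iff _ _).1 (ht.resolve_left htH) with h | h
    · obtain ⟨e, m, rfl⟩ := Walk.mem_support_iff_exists_append.1 h
      rw [← Walk.append_assoc] at hp ⊢
      rw [pathsIn_comm]
      exact ncard_pathsIn_of_append hn hp htH hsH hst.symm
    · obtain ⟨m, f, rfl⟩ := Walk.mem_support_iff_exists_append.1 h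
      exact ncard_pathsIn_of_append hn hp hsH htH hst

theorem IsEar.exists_walk_to_mem {p : G.Walk a b} (hp : IsEar H p)
    (hs : s ∈ (H ⊔ p.toSubgraph).verts) (hsv : s ≠ v) :
    ∃ u ∈ H.verts, u ≠ v ∧ ∃ q : G.Walk s u, q.toSubgraph ≤ H ⊔ p.toSubgraph ∧
      v ∉ q.support := by
  by_cases hsH : s ∈ H.verts
  · refine ⟨s, hsH, hsv, .nil, ?_, by simpa using hsv.symm⟩
    simpa [Walk.toSubgraph] using Or.inl hsH
  rw [Subgraph.verts_sup, Set.mem_union, Walk.mem_verts_toSubgraph] at hs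
  obtain ⟨e, f, rfl⟩ := Walk.mem_support_iff_exists_append.1 (hs.resolve_left hsH)
  rw [Walk.toSubgraph_append]
  by_cases hv : v ∈ e.support
  · have hvf : v ∉ f.support := fun h =>
      hsv (eq_of_mem_support_of_isPath_append hp.isPath hv h).symm
    exact ⟨b, hp.right_mem, fun h => hvf (h ▸ f.end_mem_support), f,
      le_trans le_sup_right le_sup_right, hvf⟩
  · exact ⟨a, hp.left_mem, fun h => hv (h ▸ e.start_mem_support), e.reverse,
      by simpa using le_trans le_sup_left le_sup_right, by simpa using hv⟩

theorem IsEar.hasNoCutVertex (hH : HasNoCutVertex H) {p : G.Walk a b} (hp : IsEar H p) :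
    HasNoCutVertex (H ⊔ p.toSubgraph) := by
  intro v s t hs ht hsv htv
  obtain ⟨s', hs', hsv', q, hq, hvq⟩ := hp.exists_walk_to_mem hs hsv
  obtain ⟨t', ht', htv', r, hr, hvr⟩ := hp.exists_walk_to_mem ht htv
  obtain ⟨m, hm, hvm⟩ := hH v s' t' hs' ht' hsv' htv'
  refine ⟨(q.append m).append r.reverse, ?_, ?_⟩
  · simp only [Walk.toSubgraph_append, Walk.toSubgraph_reverse]
    exact sup_le (sup_le hq (hm.trans le_sup_left)) hr
  · simp [Walk.mem_support_append_iff, hvq, hvm, hvr]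

theorem exists_isPath_subgraphOfAdj (h : G.Adj u v) (hs : s ∈ (G.subgraphOfAdj h).verts)
    (ht : t ∈ (G.subgraphOfAdj h).verts) (hst : s ≠ t) :
    ∃ p : G.Walk s t, p.IsPath ∧ p.toSubgraph ≤ G.subgraphOfAdj h ∧ p.support = [s, t] := by
  have hadj : (G.subgraphOfAdj h).Adj s t := by
    rcases hs with rfl | rfl <;> rcases ht with rfl | rfl <;> simp_all
  refine ⟨hadj.adj_sub.toWalk, by simp [hst], ?_, by simp⟩
  simpa using subgraphOfAdj_le_of_adj _ hadj

theorem hasNoCutVertex_subgraphOfAdj (h : G.Adj u v) : HasNoCutVertex (G.subgraphOfAdj h) := by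
  intro x s t hs ht hsx htx
  by_cases hst : s = t
  · subst hst
    exact ⟨.nil, by simpa [Walk.toSubgraph] using hs, by simpa using hsx.symm⟩
  · obtain ⟨p, -, hp, hps⟩ := exists_isPath_subgraphOfAdj h hs ht hst
    exact ⟨p, hp, by simp [hps, hsx.symm, htx.symm]⟩

theorem one_le_ncard_pathsIn_subgraphOfAdj [Finite V] (h : G.Adj u v)
    (hs : s ∈ (G.subgraphOfAdj h).verts) (ht : t ∈ (G.subgraphOfAdj h).verts) (hst : s ≠ t) :
    1 ≤ (pathsIn (G.subgraphOfAdj h) s t).ncard := by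
  obtain ⟨p, hp, hpH, -⟩ := exists_isPath_subgraphOfAdj h hs ht hst
  exact (Set.ncard_pos (Set.toFinite _)).2 ⟨p.toSubgraph, hpH, p, hp, rfl⟩

theorem isEar_of_isCycle_cons {h : G.Adj u v} {p : G.Walk v u} (hc : (Walk.cons h p).IsCycle) :
    IsEar (G.subgraphOfAdj h) p := by
  rw [Walk.cons_isCycle_iff] at hc
  refine ⟨hc.1, h.ne', by simp, by simp, fun x _ hx => Or.symm (by simpa using hx), ?_⟩
  intro x y hxy hxy'
  rw [subgraphOfAdj_adj] at hxy'
  rw [Walk.adj_toSubgraph_iff_mem_edges, ← hxy'] at hxy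
  exact hc.2 hxy

theorem IsCycleSubgraph.hasNoCutVertex_and_two_le [Finite V] (hC : IsCycleSubgraph H) :
    HasNoCutVertex H ∧
      ∀ s ∈ H.verts, ∀ t ∈ H.verts, s ≠ t → 2 ≤ (pathsIn H s t).ncard := by
  obtain ⟨u, c, hc, rfl⟩ := hC
  cases c with
  | nil => exact absurd hc Walk.not_isCycle_nil
  | cons h p =>
    have hp := isEar_of_isCycle_cons hc
    exact ⟨hp.hasNoCutVertex (hasNoCutVertex_subgraphOfAdj h), fun s hs t ht hst =>
      hp.add_one_le_ncard_pathsIn (hasNoCutVertex_subgraphOfAdj h)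
        (fun s hs t ht => one_le_ncard_pathsIn_subgraphOfAdj h hs ht) hs ht hst⟩

theorem IsOpenEarDecomposition.hasNoCutVertex_and_le [Finite V] {l : ℕ} {P : Fin l → G.Subgraph}
    (hP : IsOpenEarDecomposition P) (k : ℕ) (hk : k < l) :
    HasNoCutVertex (⨆ j : {j : Fin l // j.val ≤ k}, P j.1) ∧
      ∀ s ∈ (⨆ j : {j : Fin l // j.val ≤ k}, P j.1).verts,
      ∀ t ∈ (⨆ j : {j : Fin l // j.val ≤ k}, P j.1).verts, s ≠ t →
        k + 2 ≤ (pathsIn (⨆ j : {j : Fin l // j.val ≤ k}, P j.1) s t).ncard := by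
  obtain ⟨hl, -, hdisj, hcycle, hear⟩ := hP
  induction k with
  | zero =>
    have : (⨆ j : {j : Fin l // j.val ≤ 0}, P j.1) = P ⟨0, hl⟩ := by
      refine le_antisymm (iSup_le ?_) (le_iSup_of_le ⟨⟨0, hl⟩, le_rfl⟩ le_rfl)
      rintro ⟨⟨j, hj⟩, hj0⟩
      obtain rfl : j = 0 := Nat.le_zero.1 hj0
      exact le_rfl
    rw [this]
    exact hcycle.hasNoCutVertex_and_two_le
  | succ k ih =>
    obtain ⟨hcut, hcard⟩ := ih (by lia)
    obtain ⟨a, b, hab, ⟨p, hpath, hPp⟩, hinter⟩ := hear ⟨k + 1, hk⟩ k.succ_pos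
    have hsup : (⨆ j : {j : Fin l // j.val ≤ k + 1}, P j.1) =
        (⨆ j : {j : Fin l // j.val ≤ k}, P j.1) ⊔ p.toSubgraph := by
      rw [← hPp]
      refine le_antisymm (iSup_le ?_) (sup_le (iSup_le ?_) ?_)
      · rintro ⟨⟨j, hj⟩, hjk⟩
        rcases Nat.le_or_eq_of_le_succ hjk with h | h
        · exact le_sup_of_le_left (le_iSup_of_le ⟨⟨j, hj⟩, h⟩ le_rfl)
        · obtain rfl : j = k + 1 := h
          exact le_sup_right
      · rintro ⟨j, hj⟩
        exact le_iSup_of_le ⟨j, Nat.le_succ_of_le hj⟩ le_rfl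
      · exact le_iSup_of_le ⟨⟨k + 1, hk⟩, le_rfl⟩ le_rfl
    have hverts : (⨆ j : {j : Fin l // j < ⟨k + 1, hk⟩}, (P j.1).verts) =
        (⨆ j : {j : Fin l // j.val ≤ k}, P j.1).verts := by
      ext x
      simp [Subgraph.verts_iSup, Fin.lt_def]
    rw [hverts, hPp] at hinter
    have hmem : ∀ x, x ∈ p.support ∧ x ∈ (⨆ j : {j : Fin l // j.val ≤ k}, P j.1).verts ↔
        x = a ∨ x = b := fun x => by
      rw [← Walk.mem_verts_toSubgraph]
      exact Set.ext_iff.1 hinter x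
    have hp : IsEar (⨆ j : {j : Fin l // j.val ≤ k}, P j.1) p := by
      refine ⟨hpath, hab, ((hmem a).2 (Or.inl rfl)).2, ((hmem b).2 (Or.inr rfl)).2,
        fun x hx hxH => (hmem x).1 ⟨hx, hxH⟩, fun x y hxy hxy' => ?_⟩
      obtain ⟨⟨j, hj⟩, hjxy⟩ := Subgraph.iSup_adj.1 hxy'
      rw [← hPp] at hxy
      have hne : (⟨k + 1, hk⟩ : Fin l) ≠ j := by
        rintro rfl
        exact absurd hj (by simp)
      exact Set.disjoint_left.1 (hdisj _ _ hne) (Subgraph.mem_edgeSet.2 hxy)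
        (Subgraph.mem_edgeSet.2 hjxy)
    rw [hsup]
    exact ⟨hp.hasNoCutVertex hcut, fun s hs t ht hst =>
      hp.add_one_le_ncard_pathsIn hcut hcard hs ht hst⟩

theorem IsKConnected.exists_adj [Fintype V] {k : ℕ} (hG : IsKConnected k G) (hk : 0 < k)
    (hst : s ≠ t) : ∃ w, G.Adj s w := by
  obtain ⟨p⟩ := (hG.2 ∅ (by simpa)).preconnected ⟨s, by simp⟩ ⟨t, by simp⟩
  refine ⟨p.snd, (p.adj_snd fun h => hst ?_)⟩
  simpa using h.eq

end

/-- A 2-connected graph admitting an open ear decomposition with `l` ears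
contains at least `l + 1` distinct `s`-`t`-paths, for any two distinct vertices `s, t`. -/
theorem stmt0 [Fintype V] {G : SimpleGraph V} (hG : IsKConnected 2 G) {l : ℕ}
    {P : Fin l → G.Subgraph} (hP : IsOpenEarDecomposition P) (s t : V) (hst : s ≠ t) :
    l + 1 ≤ {H : G.Subgraph | IsPathSubgraph H s t}.ncard := by
  obtain ⟨hl, hedge, -⟩ := id hP
  have hmem : ∀ x y, x ≠ y → x ∈ (⨆ j : {j : Fin l // j.val ≤ l - 1}, P j.1).verts := by
    intro x y hxy
    obtain ⟨w, hw⟩ := hG.exists_adj two_pos hxy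
    obtain ⟨i, hi⟩ := (hedge s(x, w)).1 hw
    rw [Subgraph.verts_iSup]
    exact Set.mem_iUnion.2 ⟨⟨i, by lia⟩, (P i).edge_vert (Subgraph.mem_edgeSet.1 hi)⟩
  have h := (hP.hasNoCutVertex_and_le (l - 1) (by lia)).2 s (hmem s t hst) t
    (hmem t s hst.symm) hst
  calc l + 1 = l - 1 + 2 := by lia
    _ ≤ _ := h
    _ ≤ _ := Set.ncard_le_ncard (fun _ hQ => hQ.2) (Set.toFinite _)
end

section
/- Every 2-connected graph G that admits an open ear decomposition with l ears contains at least binom(l+1, 2) distinct cycles. -/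
open SimpleGraph

variable {V : Type*}

namespace SimpleGraph.Walk

variable {G : SimpleGraph V}

theorem isPath_append_iff {u v w : V} {p : G.Walk u v} {q : G.Walk v w} :
    (p.append q).IsPath ↔ p.IsPath ∧ q.IsPath ∧ ∀ x ∈ p.support, x ∈ q.support → x = v := by
  have hq := q.cons_tail_support.symm
  rw [isPath_def, isPath_def, isPath_def, support_append, List.nodup_append', hq, List.nodup_cons]
  have hv := p.end_mem_support
  constructor
  · rintro ⟨h1, h2, h3⟩
    refine ⟨h1, ⟨fun h => h3 hv (by simpa using h), by simpa using h2⟩, fun x hx hx' => ?_⟩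
    rcases List.mem_cons.1 hx' with h | h
    · exact h
    · exact (h3 hx (by simpa using h)).elim
  · rintro ⟨h1, ⟨h2, h3⟩, h4⟩
    refine ⟨h1, by simpa using h3, fun x hx hx' => ?_⟩
    have := h4 x hx (List.mem_cons_of_mem _ (by simpa using hx'))
    subst this
    exact h2 (by simpa using hx')

theorem IsPath.disjoint_edgeSet_of_append {u v w : V} {p : G.Walk u v} {q : G.Walk v w}
    (h : (p.append q).IsPath) : Disjoint p.edgeSet q.edgeSet := by
  have := edges_nodup_of_support_nodup h.support_nodup
  rw [edges_append, List.nodup_append'] at this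
  exact Set.disjoint_left.2 fun e he he' => this.2.2 he he'

theorem edgeSet_nonempty_of_ne {u v : V} (p : G.Walk u v) (h : u ≠ v) : p.edgeSet.Nonempty := by
  cases p with
  | nil => exact absurd rfl h
  | cons h p => exact ⟨_, by simp [mem_edgeSet]; exact Or.inl rfl⟩

/-- A walk that reaches `S` contains a path which stops at its first vertex in `S`. -/
theorem exists_isPath_to_first_mem {S : Set V} {y t : V} (w : G.Walk y t) (ht : t ∈ S) :
    ∃ z ∈ S, ∃ r : G.Walk y z, r.IsPath ∧ r.support ⊆ w.support ∧ r.edgeSet ⊆ w.edgeSet ∧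
      ∀ v ∈ r.support, v ∈ S → v = z := by
  classical
  suffices H : ∀ {y t : V} (w : G.Walk y t), t ∈ S → w.IsPath →
      ∃ z ∈ S, ∃ r : G.Walk y z, r.IsPath ∧ r.support ⊆ w.support ∧ r.edgeSet ⊆ w.edgeSet ∧
        ∀ v ∈ r.support, v ∈ S → v = z by
    obtain ⟨z, hz, r, h1, h2, h3, h4⟩ := H w.bypass ht w.bypass_isPath
    exact ⟨z, hz, r, h1, List.Subset.trans h2 w.support_bypass_subset_support,
      h3.trans fun e he => w.edges_bypass_subset_edges he, h4⟩
  intro y t w ht hw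
  induction w with
  | nil => exact ⟨_, ht, nil, by simp⟩
  | @cons y y' t h w ih =>
    by_cases hy : y ∈ S
    · exact ⟨y, hy, nil, by simp⟩
    · rw [cons_isPath_iff] at hw
      obtain ⟨z, hz, r, h1, h2, h3, h4⟩ := ih ht hw.1
      refine ⟨z, hz, cons h r, ?_, ?_, ?_, ?_⟩
      · rw [cons_isPath_iff]
        exact ⟨h1, fun h' => hw.2 (h2 h')⟩
      · rw [support_cons, support_cons]
        exact List.cons_subset_cons _ h2
      · rw [edgeSet_cons, edgeSet_cons]
        exact Set.insert_subset_insert h3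
      · intro v hv hvS
        rw [support_cons, List.mem_cons] at hv
        rcases hv with rfl | hv
        · exact absurd hvS hy
        · exact h4 v hv hvS

theorem support_subset_of_edgeSet_subset {W : Set V} {E : Set (Sym2 V)}
    (hE : ∀ e ∈ E, ∀ v ∈ e, v ∈ W) {u v : V} (p : G.Walk u v) (hu : u ∈ W)
    (hp : p.edgeSet ⊆ E) : ∀ x ∈ p.support, x ∈ W := by
  induction p with
  | nil => simpa using hu
  | @cons u u' v h p ih =>
    rw [edgeSet_cons, Set.insert_subset_iff] at hp
    intro x hx
    rw [support_cons, List.mem_cons] at hx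
    rcases hx with rfl | hx
    · exact hu
    · exact ih (hE _ hp.1 _ (Sym2.mem_mk_right _ _)) hp.2 x hx

end SimpleGraph.Walk

namespace SimpleGraph

open Walk

variable {G : SimpleGraph V}

/-- `G.EarBuilt n W E`: the subgraph of `G` with vertex set `W` and edge set `E` arises from a
single edge by successively attaching `n` open ears. -/
inductive EarBuilt (G : SimpleGraph V) : ℕ → Set V → Set (Sym2 V) → Prop
  | edge {u v : V} (h : G.Adj u v) : EarBuilt G 0 {u, v} {s(u, v)}
  | ear {n : ℕ} {W : Set V} {E : Set (Sym2 V)} {x y : V} (q : G.Walk x y)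
      (hWE : EarBuilt G n W E) (hne : x ≠ y) (hq : q.IsPath) (hx : x ∈ W) (hy : y ∈ W)
      (hqW : ∀ v ∈ q.support, v ∈ W → v = x ∨ v = y) (hqE : Disjoint E q.edgeSet) :
      EarBuilt G (n + 1) (W ∪ {v | v ∈ q.support}) (E ∪ q.edgeSet)

/-- `y` and `z` are joined by a walk with edges in `E` which avoids `X`. -/
def JoinedAvoiding (G : SimpleGraph V) (E : Set (Sym2 V)) (X : Set V) (y z : V) : Prop :=
  ∃ w : G.Walk y z, w.edgeSet ⊆ E ∧ ∀ v ∈ w.support, v ∉ X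

namespace JoinedAvoiding

variable {E E' : Set (Sym2 V)} {X : Set V} {x y z : V}

theorem symm (h : G.JoinedAvoiding E X y z) : G.JoinedAvoiding E X z y := by
  obtain ⟨w, h1, h2⟩ := h
  exact ⟨w.reverse, by rwa [edgeSet_reverse], by simpa using h2⟩

theorem trans (h : G.JoinedAvoiding E X x y) (h' : G.JoinedAvoiding E X y z) :
    G.JoinedAvoiding E X x z := by
  obtain ⟨w, h1, h2⟩ := h
  obtain ⟨w', h1', h2'⟩ := h'
  refine ⟨w.append w', by rw [edgeSet_append]; exact Set.union_subset h1 h1', fun v hv => ?_⟩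
  rw [mem_support_append_iff] at hv
  exact hv.elim (h2 v) (h2' v)

theorem mono (hE : E ⊆ E') (h : G.JoinedAvoiding E X y z) : G.JoinedAvoiding E' X y z := by
  obtain ⟨w, h1, h2⟩ := h
  exact ⟨w, h1.trans hE, h2⟩

end JoinedAvoiding

/-- There are disjoint paths from `a` to `x` and from `y` to `b` with edges in `E`. -/
def Linked (G : SimpleGraph V) (E : Set (Sym2 V)) (a b x y : V) : Prop :=
  ∃ (p : G.Walk a x) (r : G.Walk y b), p.IsPath ∧ r.IsPath ∧ p.edgeSet ⊆ E ∧ r.edgeSet ⊆ E ∧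
    p.support.Disjoint r.support

theorem Linked.reverse {E : Set (Sym2 V)} {a b x y : V} (h : G.Linked E a b x y) :
    G.Linked E b a y x := by
  obtain ⟨p, r, hp, hr, hpE, hrE, hd⟩ := h
  refine ⟨r.reverse, p.reverse, hr.reverse, hp.reverse, by rwa [edgeSet_reverse],
    by rwa [edgeSet_reverse], ?_⟩
  simpa using hd.symm

/-- There is a path from `a` to `b` through `x` with edges in `E`. -/
def PathThrough (G : SimpleGraph V) (E : Set (Sym2 V)) (a b x : V) : Prop :=
  ∃ (p : G.Walk a x) (r : G.Walk x b), (p.append r).IsPath ∧ p.edgeSet ⊆ E ∧ r.edgeSet ⊆ E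

namespace EarBuilt

variable {n : ℕ} {W : Set V} {E : Set (Sym2 V)} {a b x y : V}

theorem mem_of_mem_edge (h : G.EarBuilt n W E) : ∀ e ∈ E, ∀ v ∈ e, v ∈ W := by
  induction h with
  | edge h => simp
  | ear q _ _ _ _ _ _ _ ih =>
    rintro e (he | he) v hv
    · exact Or.inl (ih e he v hv)
    · exact Or.inr (q.mem_support_of_mem_edges he hv)

theorem joinedAvoiding (h : G.EarBuilt n W E) {X : Set V} (hX : X.Subsingleton) :
    ∀ y ∈ W, ∀ z ∈ W, y ∉ X → z ∉ X → G.JoinedAvoiding E X y z := by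
  induction h with
  | @edge u v h =>
    have key : u ∉ X → v ∉ X → G.JoinedAvoiding {s(u, v)} X u v := fun hu hv =>
      ⟨cons h nil, by simp, by simp [hu, hv]⟩
    have triv : ∀ y, y ∉ X → G.JoinedAvoiding {s(u, v)} X y y := fun y hy =>
      ⟨nil, by simp, by simpa using hy⟩
    rintro y (rfl | rfl) z (rfl | rfl) hy hz
    · exact triv _ hy
    · exact key hy hz
    · exact (key hz hy).symm
    · exact triv _ hy
  | @ear n W E a b q hWE hne hq ha hb hqW hqE ih =>
    have key : ∀ y ∈ W ∪ {v | v ∈ q.support}, y ∉ X →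
        ∃ y' ∈ W, y' ∉ X ∧ G.JoinedAvoiding (E ∪ q.edgeSet) X y y' := by
      rintro y (hy | hy) hyX
      · exact ⟨y, hy, hyX, nil, by simp, by simpa using hyX⟩
      · obtain ⟨q₁, q₂, -, -, rfl⟩ := hq.mem_support_iff_exists_append.1 hy
        rw [edgeSet_append]
        by_cases h1 : ∀ v ∈ q₁.support, v ∉ X
        · exact ⟨a, ha, h1 a q₁.start_mem_support, q₁.reverse,
            by rw [edgeSet_reverse]; grind, by simpa using h1⟩
        by_cases h2 : ∀ v ∈ q₂.support, v ∉ X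
        · exact ⟨b, hb, h2 b q₂.end_mem_support, q₂, by grind, h2⟩
        push Not at h1 h2
        obtain ⟨v, hv, hvX⟩ := h1
        obtain ⟨v', hv', hvX'⟩ := h2
        obtain rfl := hX hvX hvX'
        exact absurd ((isPath_append_iff.1 hq).2.2 v hv hv' ▸ hvX) hyX
    intro y hy z hz hyX hzX
    obtain ⟨y', hy', hyX', hyy⟩ := key y hy hyX
    obtain ⟨z', hz', hzX', hzz⟩ := key z hz hzX
    exact hyy.trans (((ih y' hy' z' hz' hyX' hzX').mono Set.subset_union_left).trans hzz.symm)

theorem linked_of_pathThrough (h : G.EarBuilt n W E) (ha : a ∈ W) (hb : b ∈ W) (hab : a ≠ b)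
    (hy : y ∈ W) (hxy : x ≠ y) (hx : G.PathThrough E a b x) :
    G.Linked E a b x y ∨ G.Linked E a b y x := by
  obtain ⟨p, r, hpr, hpE, hrE⟩ := hx
  obtain ⟨hp, hr, hd⟩ := isPath_append_iff.1 hpr
  obtain ⟨t, ht, htx, w, hwE, hwx⟩ : ∃ t, (t ∈ p.support ∨ t ∈ r.support) ∧ t ≠ x ∧
      G.JoinedAvoiding E {x} y t := by
    rcases eq_or_ne a x with rfl | hax
    · exact ⟨b, Or.inr (by simp), hab.symm, h.joinedAvoiding Set.subsingleton_singleton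
        _ hy _ hb (by simpa using hxy.symm) (by simpa using hab.symm)⟩
    · exact ⟨a, Or.inl (by simp), hax, h.joinedAvoiding Set.subsingleton_singleton
        _ hy _ ha (by simpa using hxy.symm) (by simpa using hax)⟩
  obtain ⟨z, hz, s, hs, hsw, hsE, hsz⟩ :=
    w.exists_isPath_to_first_mem (S := {v | v ∈ p.support ∨ v ∈ r.support}) ht
  have hzx : z ≠ x := fun hzx => hwx z (hsw s.end_mem_support) hzx
  have key : ∀ {a b : V} (p : G.Walk a x) (r : G.Walk x b), p.IsPath → r.IsPath →
      (∀ v ∈ p.support, v ∈ r.support → v = x) → p.edgeSet ⊆ E → r.edgeSet ⊆ E →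
      (∀ v ∈ s.support, v ∈ p.support ∨ v ∈ r.support → v = z) → z ∈ p.support →
      G.Linked E a b y x := by
    intro a b p r hp hr hd hpE hrE hsz hz
    obtain ⟨p₁, p₂, hp₁, hp₂, rfl⟩ := hp.mem_support_iff_exists_append.1 hz
    have hd' := (isPath_append_iff.1 hp).2.2
    simp only [mem_support_append_iff] at hd hsz
    rw [edgeSet_append] at hpE
    refine ⟨p₁.append s.reverse, r, ?_, hr, ?_, hrE, ?_⟩
    · rw [isPath_append_iff]
      refine ⟨hp₁, hs.reverse, fun v hv hv' => hsz v (by simpa using hv') (Or.inl (Or.inl hv))⟩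
    · rw [edgeSet_append, edgeSet_reverse]
      exact Set.union_subset (Set.subset_union_left.trans hpE) (hsE.trans hwE)
    · intro v hv hvr
      rw [mem_support_append_iff, support_reverse, List.mem_reverse] at hv
      rcases hv with hv | hv
      · obtain rfl := hd v (Or.inl hv) hvr
        exact hzx (hd' v hv p₂.end_mem_support).symm
      · obtain rfl := hsz v hv (Or.inr hvr)
        exact hzx (hd v (Or.inl p₁.end_mem_support) hvr)
  rcases hz with hz | hz
  · exact Or.inr (key p r hp hr hd hpE hrE hsz hz)
  · refine Or.inl (key r.reverse p.reverse hr.reverse hp.reverse ?_ ?_ ?_ ?_ ?_).reverse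
    · simpa using fun v h1 h2 => hd v h2 h1
    · rwa [edgeSet_reverse]
    · rwa [edgeSet_reverse]
    · simpa using fun v h1 h2 => hsz v h1 h2.symm
    · simpa using hz

theorem pathThrough (h : G.EarBuilt n W E) (ha : a ∈ W) (hb : b ∈ W) (hab : a ≠ b)
    (hx : x ∈ W) : G.PathThrough E a b x := by
  classical
  obtain ⟨w, hwE, -⟩ := h.joinedAvoiding Set.subsingleton_empty _ hx _ ha (by simp) (by simp)
  induction w with
  | nil =>
    obtain ⟨w, hwE, -⟩ := h.joinedAvoiding Set.subsingleton_empty _ ha _ hb (by simp) (by simp)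
    exact ⟨nil, w.bypass, by simpa using w.bypass_isPath, by simp,
      fun e he => hwE (w.edges_bypass_subset_edges he)⟩
  | @cons x x' a hadj w ih =>
    rw [edgeSet_cons, Set.insert_subset_iff] at hwE
    have hE : s(x', x) ∈ E := Sym2.eq_swap ▸ hwE.1
    rcases h.linked_of_pathThrough ha hb hab hx hadj.ne'
      (ih ha hab (h.mem_of_mem_edge _ hwE.1 _ (Sym2.mem_mk_right _ _)) hwE.2) with
      ⟨p, r, hp, hr, hpE, hrE, hd⟩ | ⟨p, r, hp, hr, hpE, hrE, hd⟩
    · refine ⟨p.concat hadj.symm, r, ?_, ?_, hrE⟩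
      · rw [concat_append, isPath_append_iff, cons_isPath_iff]
        exact ⟨hp, ⟨hr, fun hx => hd p.end_mem_support hx⟩, fun v hv hv' => by
          rw [support_cons, List.mem_cons] at hv'
          exact hv'.resolve_right (hd hv)⟩
      · rw [concat_eq_append, edgeSet_append, edgeSet_cons, edgeSet_nil]
        grind
    · refine ⟨p, cons hadj r, ?_, hpE, ?_⟩
      · rw [isPath_append_iff, cons_isPath_iff]
        exact ⟨hp, ⟨hr, hd p.end_mem_support⟩, fun v hv hv' => by
          rw [support_cons, List.mem_cons] at hv'
          exact hv'.resolve_right (hd hv)⟩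
      · rw [edgeSet_cons]
        grind

theorem linked (h : G.EarBuilt n W E) (ha : a ∈ W) (hb : b ∈ W) (hab : a ≠ b)
    (hx : x ∈ W) (hy : y ∈ W) (hxy : x ≠ y) : G.Linked E a b x y ∨ G.Linked E a b y x :=
  h.linked_of_pathThrough ha hb hab hy hxy (h.pathThrough ha hb hab hx)

end EarBuilt

theorem _root_.Disjoint.union_sdiff_eq_right {α : Type*} {E F D : Set α} (hD : Disjoint E D)
    (hF : F ⊆ E) : (F ∪ D) \ E = D := by
  rw [Set.union_sdiff_distrib, Set.sdiff_eq_empty.2 hF, Set.empty_union, hD.sdiff_eq_right]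

theorem _root_.Disjoint.injOn_union_right {α : Type*} {E D : Set α} (hD : Disjoint E D) :
    Set.InjOn (· ∪ D) {F | F ⊆ E} := by
  have hinter : ∀ F ⊆ E, (F ∪ D) ∩ E = F := fun F hF => by
    rw [Set.union_inter_distrib_right, Set.inter_eq_left.2 hF, Set.inter_comm, hD.inter_eq,
      Set.union_empty]
  intro F hF F' hF' hFF
  rw [← hinter F hF, ← hinter F' hF']
  exact congrArg (· ∩ E) hFF

/-- There are at least `k` edge sets of paths from `a` to `b` with edges in `E`. -/
def HasPaths (G : SimpleGraph V) (E : Set (Sym2 V)) (a b : V) (k : ℕ) : Prop :=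
  ∃ S : Finset (Set (Sym2 V)), k ≤ S.card ∧
    ∀ F ∈ S, F ⊆ E ∧ ∃ p : G.Walk a b, p.IsPath ∧ p.edgeSet = F

namespace HasPaths

variable {E E' D : Set (Sym2 V)} {a b a' b' : V} {k : ℕ}

theorem symm (h : G.HasPaths E a b k) : G.HasPaths E b a k := by
  obtain ⟨S, hS, hSE⟩ := h
  refine ⟨S, hS, fun F hF => ⟨(hSE F hF).1, ?_⟩⟩
  obtain ⟨p, hp, hpF⟩ := (hSE F hF).2
  exact ⟨p.reverse, hp.reverse, by rwa [edgeSet_reverse]⟩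

/-- If every path from `a'` to `b'` in `E` can be turned into a path from `a` to `b` by adding the
edges in `D`, then any additional path which does not add exactly the edges in `D` raises the
count by one. -/
theorem extend (h : G.HasPaths E a' b' k) (hD : Disjoint E D) (hE : E ∪ D ⊆ E')
    (hmap : ∀ p : G.Walk a' b', p.IsPath → p.edgeSet ⊆ E →
      ∃ p' : G.Walk a b, p'.IsPath ∧ p'.edgeSet = p.edgeSet ∪ D)
    (t : G.Walk a b) (ht : t.IsPath) (htE : t.edgeSet ⊆ E') (htD : t.edgeSet \ E ≠ D) :
    G.HasPaths E' a b (k + 1) := by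
  classical
  obtain ⟨S, hS, hSE⟩ := h
  have hnot : t.edgeSet ∉ S.image (· ∪ D) := by
    rw [Finset.mem_image]
    rintro ⟨F, hF, hFt⟩
    exact htD (hFt ▸ hD.union_sdiff_eq_right (hSE F hF).1)
  refine ⟨insert t.edgeSet (S.image (· ∪ D)), ?_, ?_⟩
  · rw [Finset.card_insert_of_notMem hnot,
      Finset.card_image_of_injOn (hD.injOn_union_right.mono fun F hF => (hSE F hF).1)]
    lia
  · intro F hF
    rw [Finset.mem_insert, Finset.mem_image] at hF
    rcases hF with rfl | ⟨F, hF, rfl⟩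
    · exact ⟨htE, t, ht, rfl⟩
    · obtain ⟨hFE, p, hp, rfl⟩ := hSE F hF
      exact ⟨(Set.union_subset_union_left D hFE).trans hE, hmap p hp hFE⟩

end HasPaths

namespace EarBuilt

variable {n k : ℕ} {W : Set V} {E : Set (Sym2 V)} {a b x y : V}

theorem exists_isPath (h : G.EarBuilt n W E) (ha : a ∈ W) (hb : b ∈ W) :
    ∃ p : G.Walk a b, p.IsPath ∧ p.edgeSet ⊆ E := by
  classical
  obtain ⟨w, hwE, -⟩ := h.joinedAvoiding Set.subsingleton_empty _ ha _ hb (by simp) (by simp)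
  exact ⟨w.bypass, w.bypass_isPath, fun e he => hwE (w.edges_bypass_subset_edges he)⟩

theorem support_subset (h : G.EarBuilt n W E) (ha : a ∈ W) (p : G.Walk a b)
    (hp : p.edgeSet ⊆ E) : ∀ v ∈ p.support, v ∈ W :=
  p.support_subset_of_edgeSet_subset h.mem_of_mem_edge ha hp

theorem hasPaths_ear_of_mem_of_mem (h : G.EarBuilt n W E) (ha : a ∈ W) (hb : b ∈ W) (hab : a ≠ b)
    (hk : G.HasPaths E a b k) {q : G.Walk x y} (hxy : x ≠ y) (hq : q.IsPath) (hx : x ∈ W)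
    (hy : y ∈ W) (hqW : ∀ v ∈ q.support, v ∈ W → v = x ∨ v = y) (hqE : Disjoint E q.edgeSet) :
    G.HasPaths (E ∪ q.edgeSet) a b (k + 1) := by
  have key : ∀ {x y : V} (q : G.Walk x y), x ≠ y → q.IsPath → x ∈ W → y ∈ W →
      (∀ v ∈ q.support, v ∈ W → v = x ∨ v = y) → Disjoint E q.edgeSet → G.Linked E a b x y →
      G.HasPaths (E ∪ q.edgeSet) a b (k + 1) := by
    rintro x y q hxy hq hx hy hqW hqE ⟨p, r, hp, hr, hpE, hrE, hd⟩
    have hpW := h.support_subset ha p hpE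
    have hrW := h.support_subset hy r hrE
    refine hk.extend (D := ∅) (by simp) (by simp) (fun p hp _ => ⟨p, hp, by simp⟩)
      (p.append (q.append r)) ?_ ?_ ?_
    · simp only [isPath_append_iff, mem_support_append_iff]
      refine ⟨hp, ⟨hq, hr, fun v hv hv' => ?_⟩, fun v hv hv' => ?_⟩
      · refine (hqW v hv (hrW v hv')).resolve_left ?_
        rintro rfl
        exact hd p.end_mem_support hv'
      · rcases hv' with hv' | hv'
        · refine (hqW v hv' (hpW v hv)).resolve_right ?_
          rintro rfl
          exact hd hv r.start_mem_support
        · exact (hd hv hv').elim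
    · simp only [edgeSet_append]
      grind
    · obtain ⟨e, he⟩ := q.edgeSet_nonempty_of_ne hxy
      refine Set.Nonempty.ne_empty ⟨e, ?_, Set.disjoint_right.1 hqE he⟩
      simp only [edgeSet_append]
      exact Or.inr (Or.inl he)
  rcases h.linked ha hb hab hx hy hxy with hl | hl
  · exact key q hxy hq hx hy hqW hqE hl
  · rw [← edgeSet_reverse] at hqE ⊢
    exact key q.reverse hxy.symm hq.reverse hy hx
      (fun v hv hvW => (hqW v (by simpa using hv) hvW).symm) hqE hl

theorem hasPaths_ear_of_mem_of_notMem (h : G.EarBuilt n W E) (ha : a ∈ W) (hb : b ∉ W)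
    (hk : G.HasPaths E a x k) (q₁ : G.Walk x b) (q₂ : G.Walk b y) (hq : (q₁.append q₂).IsPath)
    (hx : x ∈ W) (hy : y ∈ W) (hqW : ∀ v ∈ (q₁.append q₂).support, v ∈ W → v = x ∨ v = y)
    (hqE : Disjoint E (q₁.append q₂).edgeSet) :
    G.HasPaths (E ∪ (q₁.append q₂).edgeSet) a b (k + 1) := by
  obtain ⟨hq₁, hq₂, hd⟩ := isPath_append_iff.1 hq
  have hdE := hq.disjoint_edgeSet_of_append
  rw [edgeSet_append, Set.disjoint_union_right] at hqE
  simp only [mem_support_append_iff] at hqW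
  rw [edgeSet_append]
  obtain ⟨t, ht, htE⟩ := h.exists_isPath ha hy
  refine hk.extend (D := q₁.edgeSet) hqE.1 (by grind) (fun p hp hpE => ⟨p.append q₁, ?_, ?_⟩)
    (t.append q₂.reverse) ?_ ?_ ?_
  · refine isPath_append_iff.2 ⟨hp, hq₁, fun v hv hv' => ?_⟩
    refine (hqW v (Or.inl hv') (h.support_subset ha p hpE v hv)).resolve_right ?_
    rintro rfl
    exact hb (hd v hv' q₂.end_mem_support ▸ hy)
  · rw [edgeSet_append]
  · refine isPath_append_iff.2 ⟨ht, hq₂.reverse, fun v hv hv' => ?_⟩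
    rw [support_reverse, List.mem_reverse] at hv'
    refine (hqW v (Or.inr hv') (h.support_subset ha t htE v hv)).resolve_left ?_
    rintro rfl
    exact hb (hd v q₁.start_mem_support hv' ▸ hx)
  · rw [edgeSet_append, edgeSet_reverse]
    grind
  · rw [edgeSet_append, edgeSet_reverse, hqE.2.union_sdiff_eq_right htE]
    intro heq
    rw [heq, disjoint_self] at hdE
    exact (q₁.edgeSet_nonempty_of_ne fun hxb => hb (hxb ▸ hx)).ne_empty hdE

theorem hasPaths_ear_of_notMem_of_notMem (h : G.EarBuilt n W E) (ha : a ∉ W) (hb : b ∉ W)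
    (hab : a ≠ b) (hk : G.HasPaths E x y k) (q₁ : G.Walk x a) (q₂ : G.Walk a b) (q₃ : G.Walk b y)
    (hq : (q₁.append (q₂.append q₃)).IsPath) (hx : x ∈ W) (hy : y ∈ W)
    (hqW : ∀ v ∈ (q₁.append (q₂.append q₃)).support, v ∈ W → v = x ∨ v = y)
    (hqE : Disjoint E (q₁.append (q₂.append q₃)).edgeSet) :
    G.HasPaths (E ∪ (q₁.append (q₂.append q₃)).edgeSet) a b (k + 1) := by
  obtain ⟨hq₁, hq₂₃, hd⟩ := isPath_append_iff.1 hq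
  obtain ⟨hq₂, hq₃, hd'⟩ := isPath_append_iff.1 hq₂₃
  have hdE := hq.disjoint_edgeSet_of_append
  simp only [edgeSet_append, Set.disjoint_union_right] at hqE hdE
  simp only [mem_support_append_iff] at hqW hd
  simp only [edgeSet_append]
  have hxb : x ≠ b := fun hxb => hb (hxb ▸ hx)
  have hya : y ≠ a := fun hya => ha (hya ▸ hy)
  have hxa : x ≠ a := fun hxa => ha (hxa ▸ hx)
  refine hk.extend (D := q₁.edgeSet ∪ q₃.edgeSet) (by simp [hqE]) (by grind)
    (fun p hp hpE => ⟨q₁.reverse.append (p.append q₃.reverse), ?_, ?_⟩) q₂ hq₂ (by grind) ?_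
  · have hpW := h.support_subset hx p hpE
    simp only [isPath_append_iff, mem_support_append_iff, support_reverse, List.mem_reverse]
    refine ⟨hq₁.reverse, ⟨hp, hq₃.reverse, fun v hv hv' => ?_⟩, fun v hv hv' => ?_⟩
    · refine (hqW v (Or.inr (Or.inr hv')) (hpW v hv)).resolve_left ?_
      rintro rfl
      exact hxa (hd v q₁.start_mem_support (Or.inr hv'))
    · rcases hv' with hv' | hv'
      · refine (hqW v (Or.inl hv) (hpW v hv')).resolve_right ?_
        rintro rfl
        exact hya (hd v hv (Or.inr q₃.end_mem_support))
      · obtain rfl := hd v hv (Or.inr hv')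
        exact (hab (hd' v q₂.start_mem_support hv')).elim
  · simp only [edgeSet_append, edgeSet_reverse]
    grind
  · intro heq
    obtain ⟨e, he⟩ := q₁.edgeSet_nonempty_of_ne hxa
    have : e ∈ q₂.edgeSet \ E := heq ▸ Or.inl he
    exact Set.disjoint_left.1 hdE.1 he this.1

theorem hasPaths (h : G.EarBuilt n W E) :
    ∀ a ∈ W, ∀ b ∈ W, a ≠ b → G.HasPaths E a b (n + 1) := by
  induction h with
  | @edge u v h =>
    have key : G.HasPaths {s(u, v)} u v (0 + 1) :=
      ⟨{{s(u, v)}}, by simp, fun F hF => by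
        rw [Finset.mem_singleton] at hF
        exact ⟨hF.le, cons h nil, by simp [h.ne], by simp [hF]⟩⟩
    rintro a (rfl | rfl) b (rfl | rfl) hab
    · exact absurd rfl hab
    · exact key
    · exact key.symm
    · exact absurd rfl hab
  | @ear n W E x y q h hxy hq hx hy hqW hqE ih =>
    have mixed : ∀ a ∈ W, ∀ b ∉ W, b ∈ q.support →
        G.HasPaths (E ∪ q.edgeSet) a b (n + 1 + 1) := by
      intro a ha b hb hbq
      obtain ⟨q₁, q₂, -, -, rfl⟩ := hq.mem_support_iff_exists_append.1 hbq
      rcases eq_or_ne a x with rfl | hax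
      · rw [← edgeSet_reverse, reverse_append] at hqE ⊢
        rw [← isPath_reverse_iff, reverse_append] at hq
        refine h.hasPaths_ear_of_mem_of_notMem ha hb (ih a ha y hy hxy) q₂.reverse q₁.reverse hq
          hy hx (fun v hv hvW => (hqW v ?_ hvW).symm) hqE
        rw [← reverse_append] at hv
        simpa only [support_reverse, List.mem_reverse] using hv
      · exact h.hasPaths_ear_of_mem_of_notMem ha hb (ih a ha x hx hax) q₁ q₂ hq hx hy hqW hqE
    rintro a ha' b hb' hab
    by_cases ha : a ∈ W <;> by_cases hb : b ∈ W
    · exact h.hasPaths_ear_of_mem_of_mem ha hb hab (ih a ha b hb hab) hxy hq hx hy hqW hqE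
    · exact mixed a ha b hb (hb'.resolve_left hb)
    · exact (mixed b hb a ha (ha'.resolve_left ha)).symm
    · replace ha' : a ∈ q.support := ha'.resolve_left ha
      replace hb' : b ∈ q.support := hb'.resolve_left hb
      obtain ⟨q₁, q₂, hq₁, hq₂, rfl⟩ := hq.mem_support_iff_exists_append.1 ha'
      rw [mem_support_append_iff] at hb'
      rcases hb' with hb' | hb'
      · obtain ⟨q₃, q₄, -, -, rfl⟩ := hq₁.mem_support_iff_exists_append.1 hb'
        rw [← append_assoc] at hq hqW hqE ⊢
        exact (h.hasPaths_ear_of_notMem_of_notMem hb ha hab.symm (ih x hx y hy hxy) q₃ q₄ q₂ hq hx hy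
          hqW hqE).symm
      · obtain ⟨q₃, q₄, -, -, rfl⟩ := hq₂.mem_support_iff_exists_append.1 hb'
        exact h.hasPaths_ear_of_notMem_of_notMem ha hb hab (ih x hx y hy hxy) q₁ q₃ q₄ hq hx hy
          hqW hqE

/-- Closing a path through the old part with a new ear gives a cycle. -/
theorem isCycle_append (h : G.EarBuilt n W E) (hxy : x ≠ y) {q : G.Walk x y} (hq : q.IsPath)
    (hx : x ∈ W) (hqW : ∀ v ∈ q.support, v ∈ W → v = x ∨ v = y) (hqE : Disjoint E q.edgeSet)
    {p : G.Walk x y} (hp : p.IsPath) (hpE : p.edgeSet ⊆ E) : (p.append q.reverse).IsCycle := by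
  have hpW := h.support_subset hx p hpE
  cases p with
  | nil => exact absurd rfl hxy
  | cons hadj p =>
    rw [cons_isPath_iff] at hp
    rw [edgeSet_cons, Set.insert_subset_iff] at hpE
    rw [cons_append, cons_isCycle_iff, isPath_append_iff, edges_append, List.mem_append]
    refine ⟨⟨hp.1, hq.reverse, fun v hv hv' => ?_⟩, ?_⟩
    · rw [support_reverse, List.mem_reverse] at hv'
      refine (hqW v hv' (hpW v (List.mem_cons_of_mem _ hv))).resolve_left ?_
      rintro rfl
      exact hp.2 hv
    · rintro (he | he)
      · exact hp.2 (p.fst_mem_support_of_mem_edges he)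
      · rw [edges_reverse, List.mem_reverse] at he
        exact Set.disjoint_left.1 hqE hpE.1 he

theorem exists_finset_cycles (h : G.EarBuilt n W E) :
    ∃ S : Finset (Set (Sym2 V)), (n + 1).choose 2 ≤ S.card ∧
      ∀ F ∈ S, F ⊆ E ∧ ∃ (u : V) (c : G.Walk u u), c.IsCycle ∧ c.edgeSet = F := by
  classical
  induction h with
  | edge h => exact ⟨∅, by simp⟩
  | @ear n W E x y q h hxy hq hx hy hqW hqE ih =>
    obtain ⟨S, hS, hSE⟩ := ih
    obtain ⟨T, hT, hTE⟩ := h.hasPaths x hx y hy hxy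
    refine ⟨S ∪ T.image (· ∪ q.edgeSet), ?_, fun F hF => ?_⟩
    · rw [Finset.card_union_of_disjoint, Finset.card_image_of_injOn
        (hqE.injOn_union_right.mono fun F hF => (hTE F hF).1)]
      · rw [Nat.choose_succ_succ', Nat.choose_one_right]
        lia
      · rw [Finset.disjoint_left]
        intro F hF hF'
        obtain ⟨F', -, rfl⟩ := Finset.mem_image.1 hF'
        obtain ⟨e, he⟩ := q.edgeSet_nonempty_of_ne hxy
        exact Set.disjoint_left.1 hqE ((hSE _ hF).1 (Or.inr he)) he
    · rw [Finset.mem_union, Finset.mem_image] at hF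
      rcases hF with hF | ⟨F, hF, rfl⟩
      · exact ⟨(hSE F hF).1.trans Set.subset_union_left, (hSE F hF).2⟩
      · obtain ⟨hFE, p, hp, rfl⟩ := hTE F hF
        exact ⟨Set.union_subset_union_left _ hFE, x, p.append q.reverse,
          h.isCycle_append hxy hq hx hqW hqE hp hFE, by rw [edgeSet_append, edgeSet_reverse]⟩

end EarBuilt

end SimpleGraph

theorem IsCycleSubgraph.earBuilt {G : SimpleGraph V} {H : G.Subgraph} (h : IsCycleSubgraph H) :
    G.EarBuilt 1 H.verts H.edgeSet := by
  obtain ⟨u, c, hc, rfl⟩ := h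
  cases c with
  | nil => exact absurd hc (by simp)
  | @cons _ v _ hadj p =>
    rw [Walk.cons_isCycle_iff] at hc
    have := (EarBuilt.edge hadj).ear p hadj.ne' hc.1 (by simp) (by simp)
      (fun w _ hw => hw.symm) (by simpa [Walk.mem_edgeSet] using hc.2)
    convert this using 1
    · ext w
      simp only [Walk.mem_verts_toSubgraph, Walk.support_cons, List.mem_cons, Set.mem_union,
        Set.mem_insert_iff, Set.mem_singleton_iff, Set.mem_ofPred_eq]
      have := p.start_mem_support
      grind
    · rw [Walk.edgeSet_toSubgraph, Walk.edgeSet_cons, Set.singleton_union]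

theorem IsOpenEarDecomposition.earBuilt {G : SimpleGraph V} {l : ℕ} {P : Fin l → G.Subgraph}
    (hP : IsOpenEarDecomposition P) (k : ℕ) (hk : k < l) :
    G.EarBuilt (k + 1) {v | ∃ i : Fin l, i.val ≤ k ∧ v ∈ (P i).verts}
      {e | ∃ i : Fin l, i.val ≤ k ∧ e ∈ (P i).edgeSet} := by
  obtain ⟨hl, -, hdisj, hcycle, hpath⟩ := hP
  induction k with
  | zero =>
    convert hcycle.earBuilt using 1
    · ext v
      exact ⟨fun ⟨i, hi, hv⟩ => (Fin.ext (Nat.le_zero.1 hi) : i = ⟨0, hl⟩) ▸ hv,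
        fun hv => ⟨⟨0, hl⟩, le_rfl, hv⟩⟩
    · ext e
      exact ⟨fun ⟨i, hi, he⟩ => (Fin.ext (Nat.le_zero.1 hi) : i = ⟨0, hl⟩) ▸ he,
        fun he => ⟨⟨0, hl⟩, le_rfl, he⟩⟩
  | succ k ih =>
    obtain ⟨a, b, hab, ⟨q, hq, hPq⟩, hinter⟩ := hpath ⟨k + 1, hk⟩ k.succ_pos
    have hinter' : ∀ v, v ∈ q.support ∧ (∃ i : Fin l, i.val ≤ k ∧ v ∈ (P i).verts) ↔
        v = a ∨ v = b := by
      intro v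
      have := Set.ext_iff.1 hinter v
      rw [hPq] at this
      simpa [Fin.lt_def, Nat.lt_succ_iff] using this
    have hq_edges : (P ⟨k + 1, hk⟩).edgeSet = q.edgeSet := by rw [hPq, Walk.edgeSet_toSubgraph]
    have := (ih (by lia)).ear q hab hq ((hinter' a).2 (Or.inl rfl)).2
      ((hinter' b).2 (Or.inr rfl)).2 (fun v hv hvW => (hinter' v).1 ⟨hv, hvW⟩) (by
        rw [Set.disjoint_left]
        rintro e ⟨i, hi, he⟩ he'
        refine Set.disjoint_left.1 (hdisj i ⟨k + 1, hk⟩ ?_) he (hq_edges ▸ he')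
        rintro rfl
        simp at hi)
    have hsplit : ∀ p : Fin l → Prop, (∃ i, i.val ≤ k + 1 ∧ p i) ↔
        (∃ i, i.val ≤ k ∧ p i) ∨ p ⟨k + 1, hk⟩ := by
      intro p
      constructor
      · rintro ⟨i, hi, hp⟩
        rcases Nat.le_succ_iff.1 hi with hi | hi
        · exact Or.inl ⟨i, hi, hp⟩
        · exact Or.inr ((Fin.ext hi : i = ⟨k + 1, hk⟩) ▸ hp)
      · rintro (⟨i, hi, hp⟩ | hp)
        · exact ⟨i, by lia, hp⟩
        · exact ⟨_, le_rfl, hp⟩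
    convert this using 1
    · ext v
      simp only [Set.mem_ofPred_eq, hsplit, Set.mem_union, hPq, Walk.mem_verts_toSubgraph]
    · ext e
      simp only [Set.mem_ofPred_eq, hsplit, Set.mem_union, hq_edges]

/-- A 2-connected graph admitting an open ear decomposition with `l` ears
contains at least `binom(l+1, 2)` distinct cycles. -/
theorem stmt1 [Fintype V] {G : SimpleGraph V} (hG : IsKConnected 2 G) {l : ℕ}
    {P : Fin l → G.Subgraph} (hP : IsOpenEarDecomposition P) :
    (l + 1).choose 2 ≤ {H : G.Subgraph | IsCycleSubgraph H}.ncard := by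
  obtain ⟨k, rfl⟩ : ∃ k, l = k + 1 := Nat.exists_eq_succ_of_ne_zero hP.1.ne'
  obtain ⟨S, hS, hSE⟩ := (hP.earBuilt k k.lt_succ_self).exists_finset_cycles
  have hsub : (S : Set (Set (Sym2 V))) ⊆
      Subgraph.edgeSet '' {H : G.Subgraph | IsCycleSubgraph H} := by
    intro F hF
    obtain ⟨u, c, hc, rfl⟩ := (hSE F hF).2
    exact ⟨c.toSubgraph, ⟨u, c, hc, rfl⟩, c.edgeSet_toSubgraph⟩
  calc (k + 1 + 1).choose 2 ≤ S.card := hS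
    _ = (S : Set (Set (Sym2 V))).ncard := (Set.ncard_coe_finset S).symm
    _ ≤ _ := Set.ncard_le_ncard hsub (Set.toFinite _)
    _ ≤ _ := Set.ncard_image_le (Set.toFinite _)
end

section
/- Every 2-connected graph with n vertices and m edges contains at least binom(m−n+2, 2) distinct cycles. -/
open SimpleGraph

variable {V : Type*}

namespace BinaryCode

variable {ι : Type*}

/-- The vectors over `ZMod 2` that vanish outside `A`. -/
def supportedOn (A : Finset ι) : Submodule (ZMod 2) (ι → ZMod 2) where
  carrier := {v | ∀ i ∉ A, v i = 0}
  add_mem' hv hw i hi := by simp [hv i hi, hw i hi]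
  zero_mem' _ _ := rfl
  smul_mem' c v hv i hi := by simp [hv i hi]

lemma mem_supportedOn {A : Finset ι} {v : ι → ZMod 2} :
    v ∈ supportedOn A ↔ ∀ i ∉ A, v i = 0 := Iff.rfl

lemma supportedOn_mono {A B : Finset ι} (h : A ⊆ B) : supportedOn A ≤ supportedOn B :=
  fun _ hv i hi => hv i fun hA => hi (h hA)

/-- The dimension of the subcode of `C` consisting of the words supported on `A`. -/
noncomputable def subcodeRank (C : Submodule (ZMod 2) (ι → ZMod 2)) (A : Finset ι) : ℕ :=
  Module.finrank (ZMod 2) (C ⊓ supportedOn A : Submodule (ZMod 2) (ι → ZMod 2))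

/-- A circuit of `C` is a nonzero word of inclusion-minimal support. -/
def IsCircuit (C : Submodule (ZMod 2) (ι → ZMod 2)) (v : ι → ZMod 2) : Prop :=
  v ∈ C ∧ v ≠ 0 ∧ ∀ u ∈ C, u ≠ 0 → (∀ i, v i = 0 → u i = 0) → u = v

lemma IsCircuit.of_inf_supportedOn {C : Submodule (ZMod 2) (ι → ZMod 2)} {v : ι → ZMod 2}
    {A : Finset ι} (h : IsCircuit (C ⊓ supportedOn A) v) : IsCircuit C v :=
  ⟨h.1.1, h.2.1, fun u hu hu0 hs => h.2.2 u ⟨hu, fun i hi => hs i (h.1.2 i hi)⟩ hu0 hs⟩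

/-- The code `C` on the ground set `E` is indecomposable if no partition of `E` into two nonempty
parts splits `C` as a direct sum. -/
structure IsIndecomposable [DecidableEq ι] (C : Submodule (ZMod 2) (ι → ZMod 2))
    (E : Finset ι) : Prop where
  le_supportedOn : C ≤ supportedOn E
  rank_add_lt : ∀ A B : Finset ι, A ∪ B = E → Disjoint A B → A.Nonempty → B.Nonempty →
    subcodeRank C A + subcodeRank C B < Module.finrank (ZMod 2) C

/-- The linear map setting the coordinate `e` to zero. -/
def puncture [DecidableEq ι] (e : ι) : (ι → ZMod 2) →ₗ[ZMod 2] (ι → ZMod 2) where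
  toFun v i := if i = e then 0 else v i
  map_add' v w := by ext i; by_cases h : i = e <;> simp [h]
  map_smul' c v := by ext i; by_cases h : i = e <;> simp [h]

section

variable [DecidableEq ι] {C : Submodule (ZMod 2) (ι → ZMod 2)} {E : Finset ι} {e f : ι}

lemma puncture_apply (v : ι → ZMod 2) (i : ι) :
    puncture e v i = if i = e then 0 else v i := rfl

lemma eq_single_of_puncture_eq_zero {v : ι → ZMod 2} (h : puncture e v = 0) :
    v = 0 ∨ v = Pi.single e 1 := by
  have hv : ∀ i, i ≠ e → v i = 0 := fun i hi => by
    simpa [puncture_apply, hi] using congrFun h i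
  rcases (by decide : ∀ x : ZMod 2, x = 0 ∨ x = 1) (v e) with h0 | h1
  · left; ext i; by_cases hi : i = e
    · simp [hi, h0]
    · simp [hv i hi]
  · right; ext i; by_cases hi : i = e
    · subst hi; simp [h1]
    · simp [hv i hi, hi]

lemma eq_zero_of_puncture_eq_zero (he : Pi.single e 1 ∉ C) {v : ι → ZMod 2} (hv : v ∈ C)
    (h : puncture e v = 0) : v = 0 :=
  (eq_single_of_puncture_eq_zero h).resolve_right fun h' => he (h' ▸ hv)

lemma exists_isCircuit_of_map_puncture (he : Pi.single e 1 ∉ C) {w : ι → ZMod 2}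
    (h : IsCircuit (C.map (puncture e)) w) : ∃ v, IsCircuit C v ∧ puncture e v = w := by
  obtain ⟨⟨v, hv, rfl⟩, h0, hmin⟩ := h
  refine ⟨v, ⟨hv, fun h => h0 (by simp [h]), fun u hu hu0 hs => ?_⟩, rfl⟩
  have hp : puncture e u = puncture e v := by
    refine hmin _ ⟨u, hu, rfl⟩ (fun h => hu0 (eq_zero_of_puncture_eq_zero he hu h)) fun i hi => ?_
    by_cases hie : i = e
    · simp [puncture_apply, hie]
    · simp only [puncture_apply, hie, if_false] at hi ⊢
      exact hs i hi
  exact sub_eq_zero.1 (eq_zero_of_puncture_eq_zero he (C.sub_mem hu hv) (by simp [hp]))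

lemma finrank_map_puncture {D : Submodule (ZMod 2) (ι → ZMod 2)} (he : Pi.single e 1 ∉ D) :
    Module.finrank (ZMod 2) (D.map (puncture e)) = Module.finrank (ZMod 2) D := by
  rw [← LinearMap.range_domRestrict]
  refine LinearMap.finrank_range_of_inj ((injective_iff_map_eq_zero _).2 fun x hx => ?_)
  exact Subtype.ext (eq_zero_of_puncture_eq_zero he x.2 hx)

lemma subcodeRank_map_puncture (he : Pi.single e 1 ∉ C) (A : Finset ι) :
    subcodeRank (C.map (puncture e)) A = subcodeRank C (insert e A) := by
  have : C.map (puncture e) ⊓ supportedOn A =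
      (C ⊓ supportedOn (insert e A)).map (puncture e) := by
    ext w
    constructor
    · rintro ⟨⟨v, hv, rfl⟩, hw⟩
      refine ⟨v, ⟨hv, fun i hi => ?_⟩, rfl⟩
      rw [Finset.mem_insert, not_or] at hi
      simpa [puncture_apply, hi.1] using hw i hi.2
    · rintro ⟨v, ⟨hv, hvA⟩, rfl⟩
      refine ⟨⟨v, hv, rfl⟩, fun i hi => ?_⟩
      by_cases hie : i = e
      · simp [puncture_apply, hie]
      · simp [puncture_apply, hie, hvA i (by simp [hie, hi])]
  rw [subcodeRank, this, finrank_map_puncture fun h => he (Submodule.mem_inf.1 h).1, subcodeRank]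

variable [Finite ι]

lemma subcodeRank_add_le (C : Submodule (ZMod 2) (ι → ZMod 2)) (A B : Finset ι) :
    subcodeRank C A + subcodeRank C B ≤ subcodeRank C (A ∩ B) + subcodeRank C (A ∪ B) := by
  unfold subcodeRank
  rw [← Submodule.finrank_sup_add_finrank_inf_eq, add_comm]
  refine add_le_add (Submodule.finrank_mono ?_) (Submodule.finrank_mono (sup_le ?_ ?_))
  · rintro v ⟨⟨hv, hA⟩, -, hB⟩
    refine ⟨hv, fun i hi => ?_⟩
    rw [Finset.mem_inter, not_and_or] at hi
    exact hi.elim (hA i) (hB i)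
  · exact inf_le_inf_left _ (supportedOn_mono Finset.subset_union_left)
  · exact inf_le_inf_left _ (supportedOn_mono Finset.subset_union_right)

lemma finrank_le_subcodeRank_erase (hC : C ≤ supportedOn E) (e : ι) :
    Module.finrank (ZMod 2) C ≤ subcodeRank C (E.erase e) + 1 := by
  let φ : C →ₗ[ZMod 2] ZMod 2 := (LinearMap.proj e).comp C.subtype
  have h1 := φ.finrank_range_add_finrank_ker
  have h2 : Module.finrank (ZMod 2) (LinearMap.range φ) ≤ 1 := by
    simpa using Submodule.finrank_le (LinearMap.range φ)
  have h3 : Module.finrank (ZMod 2) (LinearMap.ker φ) ≤ subcodeRank C (E.erase e) := by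
    rw [← Submodule.finrank_map_subtype_eq]
    refine Submodule.finrank_mono ?_
    rintro _ ⟨v, hv, rfl⟩
    refine ⟨v.2, fun i hi => ?_⟩
    by_cases hie : i = e
    · subst hie; exact hv
    · exact hC v.2 i fun h => hi (Finset.mem_erase.2 ⟨hie, h⟩)
  omega

lemma IsIndecomposable.single_notMem (h : IsIndecomposable C E) (he : e ∈ E) (hf : f ∈ E)
    (hef : e ≠ f) : Pi.single e 1 ∉ C := by
  intro hC
  have h1 := h.rank_add_lt {e} (E.erase e) (by rw [← Finset.insert_eq, Finset.insert_erase he])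
    (by simp) (by simp) ⟨f, by simp [hef.symm, hf]⟩
  have h2 := finrank_le_subcodeRank_erase h.le_supportedOn e
  have h3 : 0 < subcodeRank C {e} := by
    refine Module.finrank_pos_iff.2 ⟨⟨⟨Pi.single e 1, hC, fun i hi => ?_⟩, 0, fun h => ?_⟩⟩
    · simp only [Finset.mem_singleton] at hi
      simp [hi]
    · simpa using congrFun (congrArg Subtype.val h) e
  omega

/-- Deleting or contracting a coordinate of an indecomposable code preserves indecomposability in
at least one of the two cases. -/
lemma IsIndecomposable.delete_or_contract (h : IsIndecomposable C E) (he : e ∈ E) :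
    IsIndecomposable (C ⊓ supportedOn (E.erase e)) (E.erase e) ∨
      Pi.single e 1 ∉ C ∧ IsIndecomposable (C.map (puncture e)) (E.erase e) := by
  by_cases hf : ∃ f ∈ E, e ≠ f
  swap
  · push Not at hf
    refine Or.inl ⟨inf_le_right, fun A B hAB _ ⟨a, ha⟩ _ => ?_⟩
    have : a ∈ E.erase e := hAB ▸ Finset.mem_union_left _ ha
    rw [Finset.mem_erase] at this
    exact absurd (hf a this.2) this.1.symm
  obtain ⟨f, hfE, hef⟩ := hf
  have hs := h.single_notMem he hfE hef
  by_contra! hcon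
  obtain ⟨h1, h2⟩ := hcon
  replace h2 := h2 hs
  have hpl : C.map (puncture e) ≤ supportedOn (E.erase e) := by
    rintro _ ⟨v, hv, rfl⟩ i hi
    by_cases hie : i = e
    · simp [puncture_apply, hie]
    · simp [puncture_apply, hie, h.le_supportedOn hv i fun h => hi (Finset.mem_erase.2 ⟨hie, h⟩)]
  have h1' : ∃ A B : Finset ι, A ∪ B = E.erase e ∧ Disjoint A B ∧ A.Nonempty ∧ B.Nonempty ∧
      Module.finrank (ZMod 2) C ≤ subcodeRank C A + subcodeRank C B + 1 := by
    by_contra! hc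
    refine h1 ⟨inf_le_right, fun A B hAB hd hA hB => ?_⟩
    have hr : ∀ X ⊆ E.erase e, subcodeRank (C ⊓ supportedOn (E.erase e)) X = subcodeRank C X := by
      intro X hX
      rw [subcodeRank, inf_assoc, inf_eq_right.2 (supportedOn_mono hX), subcodeRank]
    rw [hr A (hAB ▸ Finset.subset_union_left), hr B (hAB ▸ Finset.subset_union_right)]
    have := hc A B hAB hd hA hB
    have := finrank_le_subcodeRank_erase h.le_supportedOn e
    unfold subcodeRank at *
    omega
  have h2' : ∃ A B : Finset ι, A ∪ B = E.erase e ∧ Disjoint A B ∧ A.Nonempty ∧ B.Nonempty ∧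
      Module.finrank (ZMod 2) C ≤ subcodeRank C (insert e A) + subcodeRank C (insert e B) := by
    by_contra! hc
    refine h2 ⟨hpl, fun A B hAB hd hA hB => ?_⟩
    rw [subcodeRank_map_puncture hs, subcodeRank_map_puncture hs, finrank_map_puncture hs]
    exact hc A B hAB hd hA hB
  obtain ⟨A, B, hAB, hdAB, hA, hB, hr⟩ := h1'
  obtain ⟨A', B', hAB', hdAB', hA', hB', hr'⟩ := h2'
  have hmem : ∀ x, x ∈ A ∨ x ∈ B ↔ x ≠ e ∧ x ∈ E := fun x => by
    rw [← Finset.mem_union, hAB, Finset.mem_erase]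
  have hmem' : ∀ x, x ∈ A' ∨ x ∈ B' ↔ x ≠ e ∧ x ∈ E := fun x => by
    rw [← Finset.mem_union, hAB', Finset.mem_erase]
  rw [Finset.disjoint_left] at hdAB hdAB'
  have key : ∀ X Y X' Y' : Finset ι, (∀ x, x ∈ X ∨ x ∈ Y ↔ x ≠ e ∧ x ∈ E) →
      (∀ x, x ∈ X' ∨ x ∈ Y' ↔ x ≠ e ∧ x ∈ E) → (∀ x ∈ X, x ∉ Y) → (∀ x ∈ X', x ∉ Y') →
      Module.finrank (ZMod 2) C ≤ subcodeRank C X + subcodeRank C Y + 1 →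
      Module.finrank (ZMod 2) C ≤ subcodeRank C (insert e X') + subcodeRank C (insert e Y') →
      X ∩ X' = ∅ ∨ Y ∩ Y' = ∅ := by
    intro X Y X' Y' hXY hXY' hd hd' hrk hrk'
    have heX : ∀ x, x ∈ X ∨ x ∈ Y → x ≠ e := fun x hx => ((hXY x).1 hx).1
    have heX' : ∀ x, x ∈ X' ∨ x ∈ Y' → x ≠ e := fun x hx => ((hXY' x).1 hx).1
    by_contra! hne
    have i1 := subcodeRank_add_le C X (insert e X')
    have i2 := subcodeRank_add_le C Y (insert e Y')
    have e1 : X ∩ insert e X' = X ∩ X' := by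
      ext x; simp only [Finset.mem_inter, Finset.mem_insert]; grind
    have e2 : Y ∩ insert e Y' = Y ∩ Y' := by
      ext x; simp only [Finset.mem_inter, Finset.mem_insert]; grind
    rw [e1] at i1
    rw [e2] at i2
    have j1 := h.rank_add_lt (X ∩ X') (Y ∪ insert e Y') (by
        ext x
        simp only [Finset.mem_inter, Finset.mem_insert, Finset.mem_union]
        by_cases hx : x = e <;> grind)
      (Finset.disjoint_left.2 fun x hx => by
        simp only [Finset.mem_inter, Finset.mem_insert, Finset.mem_union] at hx ⊢
        grind) hne.1 ⟨e, by simp⟩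
    have j2 := h.rank_add_lt (Y ∩ Y') (X ∪ insert e X') (by
        ext x
        simp only [Finset.mem_inter, Finset.mem_insert, Finset.mem_union]
        by_cases hx : x = e <;> grind)
      (Finset.disjoint_left.2 fun x hx => by
        simp only [Finset.mem_inter, Finset.mem_insert, Finset.mem_union] at hx ⊢
        grind) hne.2 ⟨e, by simp⟩
    omega
  have k1 := key A B A' B' hmem hmem' hdAB hdAB' hr hr'
  have k2 := key A B B' A' hmem (fun x => or_comm.trans (hmem' x)) hdAB
    (fun x hx hx' => hdAB' hx' hx) hr (by omega)
  simp only [Finset.eq_empty_iff_forall_notMem, Finset.mem_inter] at k1 k2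
  obtain ⟨a, ha⟩ := hA
  obtain ⟨b, hb⟩ := hB
  obtain ⟨a', ha'⟩ := hA'
  obtain ⟨b', hb'⟩ := hB'
  have m1 := (hmem' a).2 ((hmem a).1 (Or.inl ha))
  have m2 := (hmem' b).2 ((hmem b).1 (Or.inr hb))
  have m3 := (hmem a').2 ((hmem' a').1 (Or.inl ha'))
  have m4 := (hmem b').2 ((hmem' b').1 (Or.inr hb'))
  rcases k1 with k1 | k1 <;> rcases k2 with k2 | k2
  · exact m1.elim (fun m => k1 a ⟨ha, m⟩) (fun m => k2 a ⟨ha, m⟩)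
  · exact m3.elim (fun m => k1 a' ⟨m, ha'⟩) (fun m => k2 a' ⟨m, ha'⟩)
  · exact m4.elim (fun m => k2 b' ⟨m, hb'⟩) (fun m => k1 b' ⟨m, hb'⟩)
  · exact m2.elim (fun m => k2 b ⟨hb, m⟩) (fun m => k1 b ⟨hb, m⟩)

/-- Any two coordinates of an indecomposable code lie in a common circuit. -/
lemma IsIndecomposable.exists_isCircuit_of_ne (h : IsIndecomposable C E) (he : e ∈ E) (hf : f ∈ E)
    (hef : e ≠ f) : ∃ v, IsCircuit C v ∧ v e ≠ 0 ∧ v f ≠ 0 := by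
  induction hn : E.card generalizing C E with
  | zero => simp [Finset.card_eq_zero.1 hn] at he
  | succ n ih =>
    by_cases hg : ∃ g ∈ E, g ≠ e ∧ g ≠ f
    · obtain ⟨g, hgE, hge, hgf⟩ := hg
      have hcard : (E.erase g).card = n := by rw [Finset.card_erase_of_mem hgE, hn]; rfl
      have he' : e ∈ E.erase g := Finset.mem_erase.2 ⟨hge.symm, he⟩
      have hf' : f ∈ E.erase g := Finset.mem_erase.2 ⟨hgf.symm, hf⟩
      rcases h.delete_or_contract hgE with h' | ⟨hs, h'⟩
      · obtain ⟨v, hv, hve, hvf⟩ := ih h' he' hf' hcard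
        exact ⟨v, hv.of_inf_supportedOn, hve, hvf⟩
      · obtain ⟨w, hw, hwe, hwf⟩ := ih h' he' hf' hcard
        obtain ⟨v, hv, rfl⟩ := exists_isCircuit_of_map_puncture hs hw
        simp only [puncture_apply, hge.symm, hgf.symm, if_false] at hwe hwf
        exact ⟨v, hv, hwe, hwf⟩
    · push Not at hg
      have hsup : ∀ v ∈ C, ∀ i, i ≠ e → i ≠ f → v i = 0 := fun v hv i hie hif =>
        h.le_supportedOn hv i fun hi => hif (hg i hi hie)
      have hne : C ≠ ⊥ := by
        rintro rfl
        have := h.rank_add_lt {e} (E.erase e)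
          (by rw [← Finset.insert_eq, Finset.insert_erase he])
          (by simp) (by simp) ⟨f, by simp [hef.symm, hf]⟩
        simp at this
      obtain ⟨v, hv, hv0⟩ := (Submodule.ne_bot_iff _).1 hne
      have hnz : ∀ u ∈ C, u ≠ 0 → u e = 1 ∧ u f = 1 := by
        intro u hu hu0
        have hz := (by decide : ∀ x : ZMod 2, x = 0 ∨ x = 1)
        have hsing : ∀ a b : ι, (∀ i, i ≠ a → i ≠ b → u i = 0) → Pi.single a 1 ∉ C → u b ≠ 0 := by
          intro a b hab hna hub
          refine hu0 (eq_zero_of_puncture_eq_zero hna hu (funext fun i => ?_))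
          by_cases hia : i = a
          · simp [puncture_apply, hia]
          · by_cases hib : i = b
            · simp [puncture_apply, hib, hub]
            · simp [puncture_apply, hab i hia hib]
        exact ⟨(hz _).resolve_left (hsing f e (fun i h1 h2 => hsup u hu i h2 h1)
            (h.single_notMem hf he hef.symm)),
          (hz _).resolve_left (hsing e f (hsup u hu) (h.single_notMem he hf hef))⟩
      have hv1 := hnz v hv hv0
      refine ⟨v, ⟨hv, hv0, fun u hu hu0 _ => funext fun i => ?_⟩, by simp [hv1.1], by simp [hv1.2]⟩
      have hu1 := hnz u hu hu0
      by_cases hie : i = e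
      · rw [hie, hu1.1, hv1.1]
      · by_cases hif : i = f
        · rw [hif, hu1.2, hv1.2]
        · rw [hsup u hu i hie hif, hsup v hv i hie hif]

/-- At least `dim C` circuits of an indecomposable code pass through a given coordinate. -/
lemma IsIndecomposable.finrank_le_ncard_isCircuit (h : IsIndecomposable C E) (he : e ∈ E) :
    Module.finrank (ZMod 2) C ≤ {v | IsCircuit C v ∧ v e ≠ 0}.ncard := by
  induction hn : E.card generalizing C E with
  | zero => simp [Finset.card_eq_zero.1 hn] at he
  | succ n ih =>
    by_cases hf : ∃ f ∈ E, e ≠ f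
    · obtain ⟨f, hfE, hef⟩ := hf
      have hcard : (E.erase f).card = n := by rw [Finset.card_erase_of_mem hfE, hn]; rfl
      have he' : e ∈ E.erase f := Finset.mem_erase.2 ⟨hef, he⟩
      rcases h.delete_or_contract hfE with h' | ⟨hs, h'⟩
      · obtain ⟨v, hv, hve, hvf⟩ := h.exists_isCircuit_of_ne he hfE hef
        have hlt : {v | IsCircuit (C ⊓ supportedOn (E.erase f)) v ∧ v e ≠ 0}.ncard <
            {v | IsCircuit C v ∧ v e ≠ 0}.ncard := by
          refine Set.ncard_lt_ncard ⟨fun u hu => ⟨hu.1.of_inf_supportedOn, hu.2⟩, fun hsub => ?_⟩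
            (Set.toFinite _)
          exact hvf ((hsub ⟨hv, hve⟩ : _ ∧ _).1.1.2 f (Finset.notMem_erase f E))
        have := ih h' he' hcard
        have := finrank_le_subcodeRank_erase h.le_supportedOn f
        unfold subcodeRank at this
        omega
      · rw [← finrank_map_puncture hs]
        refine (ih h' he' hcard).trans ?_
        refine (Set.ncard_le_ncard (t := puncture f '' {v | IsCircuit C v ∧ v e ≠ 0}) ?_
          (Set.toFinite _)).trans (Set.ncard_image_le (Set.toFinite _))
        rintro w ⟨hw, hwe⟩
        obtain ⟨v, hv, rfl⟩ := exists_isCircuit_of_map_puncture hs hw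
        exact ⟨v, ⟨hv, by simpa [puncture_apply, hef] using hwe⟩, rfl⟩
    · push Not at hf
      by_cases hC : C = ⊥
      · subst hC; simp
      obtain ⟨v, hv, hv0⟩ := (Submodule.ne_bot_iff _).1 hC
      have hone : ∀ u ∈ C, u ≠ 0 → u = Pi.single e 1 := fun u hu hu0 => by
        refine (eq_single_of_puncture_eq_zero (funext fun i => ?_)).resolve_left hu0
        by_cases hie : i = e
        · simp [puncture_apply, hie]
        · simpa [puncture_apply, hie] using
            h.le_supportedOn hu i fun hi => hie (hf i hi).symm
      have hve := hone v hv hv0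
      have h1 : 0 < {v | IsCircuit C v ∧ v e ≠ 0}.ncard := by
        rw [Set.ncard_pos (Set.toFinite _)]
        exact ⟨v, ⟨hv, hv0, fun u hu hu0 _ => (hone u hu hu0).trans hve.symm⟩, by simp [hve]⟩
      have h2 := finrank_le_subcodeRank_erase h.le_supportedOn e
      have h3 : subcodeRank C (E.erase e) = 0 := by
        rw [subcodeRank, Submodule.finrank_eq_zero, eq_bot_iff]
        rintro u ⟨hu, huE⟩
        by_contra hu0
        have := huE e (Finset.notMem_erase e E)
        rw [hone u hu hu0] at this
        simp at this
      omega

/-- An indecomposable binary code of dimension `d` has at least `(d + 1).choose 2` circuits. -/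
theorem IsIndecomposable.choose_le_ncard_isCircuit (h : IsIndecomposable C E) :
    (Module.finrank (ZMod 2) C + 1).choose 2 ≤ {v | IsCircuit C v}.ncard := by
  induction hn : E.card generalizing C E with
  | zero =>
    have hC : C = ⊥ := by
      rw [eq_bot_iff]
      intro v hv
      exact funext fun i => h.le_supportedOn hv i (by simp [Finset.card_eq_zero.1 hn])
    subst hC
    simp
  | succ n ih =>
    obtain ⟨e, he⟩ : E.Nonempty := Finset.card_pos.1 (by omega)
    have hcard : (E.erase e).card = n := by rw [Finset.card_erase_of_mem he, hn]; rfl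
    rcases h.delete_or_contract he with h' | ⟨hs, h'⟩
    · have h1 := ih h' hcard
      have h2 := finrank_le_subcodeRank_erase h.le_supportedOn e
      have h3 := h.finrank_le_ncard_isCircuit he
      have h4 : {v | IsCircuit (C ⊓ supportedOn (E.erase e)) v}.ncard +
          {v | IsCircuit C v ∧ v e ≠ 0}.ncard ≤ {v | IsCircuit C v}.ncard := by
        rw [← Set.ncard_union_eq (Set.disjoint_left.2 fun v hv hv' =>
          hv'.2 (hv.1.2 e (Finset.notMem_erase e E))) (Set.toFinite _) (Set.toFinite _)]
        refine Set.ncard_le_ncard ?_ (Set.toFinite _)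
        rintro v (hv | hv)
        exacts [hv.of_inf_supportedOn, hv.1]
      have h5 : (Module.finrank (ZMod 2) C + 1).choose 2 =
          Module.finrank (ZMod 2) C + (Module.finrank (ZMod 2) C).choose 2 := by
        rw [Nat.choose_succ_succ', Nat.choose_one_right]
      have h6 := Nat.choose_le_choose 2 h2
      unfold subcodeRank at h6
      omega
    · rw [← finrank_map_puncture hs]
      refine (ih h' hcard).trans ?_
      refine (Set.ncard_le_ncard (t := puncture e '' {v | IsCircuit C v}) ?_
        (Set.toFinite _)).trans (Set.ncard_image_le (Set.toFinite _))
      intro w hw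
      obtain ⟨v, hv, rfl⟩ := exists_isCircuit_of_map_puncture hs hw
      exact ⟨v, hv, rfl⟩

end

end BinaryCode

namespace SimpleGraph

open BinaryCode

/-- The coboundary of a vertex labelling over `ZMod 2`: it sends the edge `ab` to `φ a + φ b`. -/
def coboundary (φ : V → ZMod 2) : Sym2 V → ZMod 2 :=
  Sym2.lift ⟨fun a b => φ a + φ b, fun _ _ => add_comm _ _⟩

lemma coboundary_mk (φ : V → ZMod 2) (a b : V) : coboundary φ s(a, b) = φ a + φ b := rfl

section

variable [Fintype V] [DecidableEq V]

/-- The boundary map over `ZMod 2` from vectors indexed by pairs of vertices to vectors indexed by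
vertices. -/
def boundary : (Sym2 V → ZMod 2) →ₗ[ZMod 2] (V → ZMod 2) where
  toFun f v := ∑ e, f e * coboundary (Pi.single v 1) e
  map_add' f g := by ext v; simp [add_mul, Finset.sum_add_distrib]
  map_smul' c f := by ext v; simp [mul_assoc, Finset.mul_sum]

lemma boundary_apply (f : Sym2 V → ZMod 2) (v : V) :
    boundary f v = ∑ e, f e * coboundary (Pi.single v 1) e := rfl

lemma sum_mul_boundary (f : Sym2 V → ZMod 2) (φ : V → ZMod 2) :
    ∑ v, φ v * boundary f v = ∑ e, f e * coboundary φ e := by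
  simp only [boundary_apply, Finset.mul_sum]
  rw [Finset.sum_comm]
  refine Finset.sum_congr rfl fun e _ => ?_
  induction e with
  | _ a b =>
    simp only [coboundary_mk, Pi.single_apply, mul_add, Finset.sum_add_distrib]
    simp [mul_comm]

/-- The binary cycle space of a graph whose edge set is the finite set `E`. -/
def cycleSpace (E : Finset (Sym2 V)) : Submodule (ZMod 2) (Sym2 V → ZMod 2) :=
  supportedOn E ⊓ LinearMap.ker boundary

lemma mem_cycleSpace {E : Finset (Sym2 V)} {f : Sym2 V → ZMod 2} :
    f ∈ cycleSpace E ↔ (∀ e ∉ E, f e = 0) ∧ ∀ φ, ∑ e, f e * coboundary φ e = 0 := by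
  refine and_congr Iff.rfl ⟨fun h φ => ?_, fun h => funext fun v => h _⟩
  rw [← sum_mul_boundary, LinearMap.mem_ker.1 h]
  simp

lemma card_le_finrank_supportedOn {ι : Type*} [Finite ι] (E : Finset ι) :
    E.card ≤ Module.finrank (ZMod 2) (supportedOn E) := by
  let g : (E → ZMod 2) →ₗ[ZMod 2] supportedOn E :=
    (Function.ExtendByZero.linearMap (ZMod 2) (Subtype.val : E → ι)).codRestrict _ fun v i hi => by
      simp only [Function.ExtendByZero.linearMap_apply]
      rw [Function.extend_apply']
      · rfl
      · rintro ⟨a, rfl⟩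
        exact hi a.2
  have hg : Function.Injective g := fun v w h => funext fun i => by
    have := congrFun (congrArg Subtype.val h) i
    change Function.extend Subtype.val v 0 i.1 = Function.extend Subtype.val w 0 i.1 at this
    simpa only [Subtype.val_injective.extend_apply] using this
  simpa using LinearMap.finrank_le_finrank_of_injective hg

lemma card_add_one_le_finrank_cycleSpace [Nonempty V] (E : Finset (Sym2 V)) :
    E.card + 1 ≤ Module.finrank (ZMod 2) (cycleSpace E) + Fintype.card V := by
  have h1 := Submodule.finrank_sup_add_finrank_inf_eq (supportedOn E)
    (LinearMap.ker (boundary (V := V)))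
  have h2 := (boundary (V := V)).finrank_range_add_finrank_ker
  have h3 := Submodule.finrank_le (supportedOn E ⊔ LinearMap.ker (boundary (V := V)))
  have h4 := card_le_finrank_supportedOn E
  have h5 : Module.finrank (ZMod 2) (LinearMap.range (boundary (V := V))) <
      Module.finrank (ZMod 2) (V → ZMod 2) := by
    refine Submodule.finrank_lt fun htop => ?_
    obtain ⟨v⟩ := ‹Nonempty V›
    obtain ⟨f, hf⟩ : Pi.single v 1 ∈ LinearMap.range (boundary (V := V)) := htop ▸ trivial
    have h := sum_mul_boundary f fun _ => 1
    have hc : coboundary (fun _ : V => (1 : ZMod 2)) = 0 := by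
      ext e
      induction e with
      | _ a b => rfl
    rw [hf, hc] at h
    simp at h
  rw [Module.finrank_fintype_fun_eq_card] at h5
  unfold cycleSpace
  omega

end

namespace Walk

variable [DecidableEq V] {G : SimpleGraph V}

/-- The sum over `ZMod 2` of the edges of a walk. -/
def edgeVector {u v : V} (p : G.Walk u v) : Sym2 V → ZMod 2 :=
  fun e => p.edges.count e

lemma edgeVector_cons {u v w : V} (h : G.Adj u v) (p : G.Walk v w) :
    (p.cons h).edgeVector = Pi.single s(u, v) 1 + p.edgeVector := by
  ext e
  by_cases he : s(u, v) = e
  · subst he; simp [edgeVector, add_comm]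
  · simp [edgeVector, he, Ne.symm he]

lemma edgeVector_eq_zero {u v : V} {p : G.Walk u v} {e : Sym2 V} (he : e ∉ p.edges) :
    p.edgeVector e = 0 := by
  simp [edgeVector, List.count_eq_zero_of_not_mem he]

lemma IsTrail.edgeVector_eq_one {u v : V} {p : G.Walk u v} (hp : p.IsTrail) {e : Sym2 V}
    (he : e ∈ p.edges) : p.edgeVector e = 1 := by
  simp [edgeVector, List.count_eq_one_of_mem hp.edges_nodup he]

variable [Fintype V]

lemma sum_edgeVector_mul_coboundary {u v : V} (p : G.Walk u v) (φ : V → ZMod 2) :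
    ∑ e, p.edgeVector e * coboundary φ e = φ u + φ v := by
  induction p with
  | nil => simp [edgeVector, CharTwo.add_self_eq_zero]
  | @cons u v w h p ih =>
    simp only [edgeVector_cons, Pi.add_apply, add_mul, Finset.sum_add_distrib, ih]
    simp only [Pi.single_apply, ite_mul, one_mul, zero_mul, Finset.sum_ite_eq', Finset.mem_univ,
      if_true, coboundary_mk]
    linear_combination CharTwo.add_self_eq_zero (φ v)

lemma edgeVector_mem_cycleSpace {u : V} (p : G.Walk u u) {E : Finset (Sym2 V)}
    (hE : ∀ e ∈ p.edges, e ∈ E) : p.edgeVector ∈ cycleSpace E :=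
  mem_cycleSpace.2 ⟨fun e he => edgeVector_eq_zero fun h => he (hE e h), fun φ => by
    rw [sum_edgeVector_mul_coboundary, CharTwo.add_self_eq_zero]⟩

end Walk

section

variable [Fintype V] [DecidableEq V] {G : SimpleGraph V} [DecidableRel G.Adj]

/-- The support of a nonzero element of the cycle space contains the edge set of a cycle. -/
lemma exists_isCycle_of_mem_cycleSpace {f : Sym2 V → ZMod 2}
    (hf : f ∈ cycleSpace G.edgeFinset) (hf0 : f ≠ 0) :
    ∃ (u : V) (c : G.Walk u u), c.IsCycle ∧ ∀ e ∈ c.edges, f e ≠ 0 := by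
  obtain ⟨hE, hbd⟩ := mem_cycleSpace.1 hf
  obtain ⟨e, he⟩ := Function.ne_iff.1 hf0
  have hmem : ∀ e, f e ≠ 0 → e ∈ G.edgeSet := fun e he => by
    by_contra h
    exact he (hE e (by simpa using h))
  let H : SimpleGraph V := fromEdgeSet {e | f e ≠ 0}
  have hHG : H ≤ G := fun a b hab => hmem _ ((fromEdgeSet_adj _).1 hab).1
  induction e with
  | _ x y =>
  have hxy : H.Adj x y := (fromEdgeSet_adj _).2 ⟨he, (hmem _ he).ne⟩
  have hreach : (H.deleteEdges {s(x, y)}).Reachable x y := by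
    classical
    by_contra hn
    have h := hbd fun v => if (H.deleteEdges {s(x, y)}).Reachable x v then 1 else 0
    rw [Finset.sum_eq_single s(x, y)] at h
    · simp [coboundary_mk, hn] at h
      exact he h
    · intro e _ hne
      induction e with
      | _ a b =>
      by_cases hab : f s(a, b) = 0
      · simp [hab]
      have hadj : (H.deleteEdges {s(x, y)}).Adj a b :=
        deleteEdges_adj.2 ⟨(fromEdgeSet_adj _).2 ⟨hab, (hmem _ hab).ne⟩, hne⟩
      have hiff : (H.deleteEdges {s(x, y)}).Reachable x a ↔
          (H.deleteEdges {s(x, y)}).Reachable x b :=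
        ⟨fun h => h.trans hadj.reachable, fun h => h.trans hadj.symm.reachable⟩
      simp only [coboundary_mk, hiff, CharTwo.add_self_eq_zero, mul_zero]
    · simp
  obtain ⟨u, p, hp, -⟩ := adj_and_reachable_delete_edges_iff_exists_cycle.1 ⟨hxy, hreach⟩
  refine ⟨u, p.mapLe hHG, hp.mapLe hHG, fun e he => ?_⟩
  rw [Walk.edges_mapLe_eq_edges] at he
  have := p.edges_subset_edgeSet he
  rw [edgeSet_fromEdgeSet] at this
  exact this.1

/-- Distinct circuits of the cycle space yield distinct cycles of the graph. -/
lemma ncard_isCircuit_cycleSpace_le :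
    {f | IsCircuit (cycleSpace G.edgeFinset) f}.ncard ≤
      {H : G.Subgraph | IsCycleSubgraph H}.ncard := by
  have key : ∀ f, IsCircuit (cycleSpace G.edgeFinset) f →
      ∃ H : G.Subgraph, IsCycleSubgraph H ∧ ∀ e, e ∈ H.edgeSet ↔ f e ≠ 0 := by
    intro f hf
    obtain ⟨u, c, hc, hcf⟩ := exists_isCycle_of_mem_cycleSpace hf.1 hf.2.1
    refine ⟨c.toSubgraph, ⟨u, c, hc, rfl⟩, fun e => ?_⟩
    have hne : c.edgeVector ≠ 0 := by
      obtain ⟨e, he⟩ := List.exists_mem_of_ne_nil c.edges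
        fun h => hc.ne_nil (Walk.edges_eq_nil.1 h).eq_nil
      intro h
      simpa [hc.isTrail.edgeVector_eq_one he] using congrFun h e
    have heq : c.edgeVector = f := hf.2.2 _
      (c.edgeVector_mem_cycleSpace fun e he => mem_edgeFinset.2 (c.edges_subset_edgeSet he)) hne
      fun e he => Walk.edgeVector_eq_zero fun h => hcf e h he
    rw [Walk.mem_edges_toSubgraph]
    refine ⟨hcf e, fun h => ?_⟩
    by_contra hn
    exact h (heq ▸ Walk.edgeVector_eq_zero hn)
  choose! F hF hFe using key
  refine Set.ncard_le_ncard_of_injOn F (fun f hf => hF f hf) ?_ (Set.toFinite _)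
  intro f hf g hg hfg
  ext e
  have h := hFe f hf e
  rw [hfg, hFe g hg e] at h
  revert h
  generalize f e = a
  generalize g e = b
  revert a b
  decide

end

end SimpleGraph

section

variable [Fintype V] {G : SimpleGraph V}

lemma IsKConnected.connected {k : ℕ} (hG : IsKConnected (k + 1) G) : G.Connected := by
  have h := hG.2 ∅ (by simp)
  rw [Finset.coe_empty, Set.compl_empty] at h
  exact (SimpleGraph.induceUnivIso G).connected_iff.1 h

open BinaryCode

lemma IsKConnected.isIndecomposable_cycleSpace [DecidableEq V] [DecidableRel G.Adj]
    (hG : IsKConnected 2 G) :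
    IsIndecomposable (cycleSpace G.edgeFinset) G.edgeFinset := by
  refine ⟨inf_le_left, fun A B hAB hd hA hB => ?_⟩
  have hmem : ∀ e, e ∈ A ∨ e ∈ B ↔ e ∈ G.edgeSet := fun e => by
    rw [← Finset.mem_union, hAB, mem_edgeFinset]
  rw [Finset.disjoint_left] at hd
  obtain ⟨x, a, b, hxa, hxb⟩ : ∃ x a b, s(x, a) ∈ A ∧ s(x, b) ∈ B := by
    by_contra! hcon
    obtain ⟨ea, ha⟩ := hA
    obtain ⟨eb, hb⟩ := hB
    induction ea with
    | _ p q =>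
    induction eb with
    | _ r s =>
    have hstep : ∀ u v, G.Adj u v → (∃ w, s(u, w) ∈ A) → ∃ w, s(v, w) ∈ A := by
      rintro u v huv ⟨w, hw⟩
      refine ⟨u, ?_⟩
      rw [Sym2.eq_swap]
      exact ((hmem _).2 huv).resolve_right (hcon u w v hw)
    have hall : ∀ u v, G.Walk u v → (∃ w, s(u, w) ∈ A) → ∃ w, s(v, w) ∈ A := by
      intro u v p
      induction p with
      | nil => exact id
      | cons h _ ih => exact fun hu => ih (hstep _ _ h hu)
    obtain ⟨w, hw⟩ := hall p r (hG.connected.preconnected p r).some ⟨q, ha⟩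
    exact hcon r w s hw hb
  have hAxa : G.Adj x a := (hmem _).1 (Or.inl hxa)
  have hAxb : G.Adj x b := (hmem _).1 (Or.inr hxb)
  have hab : a ≠ b := by
    rintro rfl
    exact hd hxa hxb
  obtain ⟨p, hp⟩ : ∃ p : G.Walk a b, x ∉ p.support := by
    have h := hG.2 {x} (by simp)
    let p := (h.preconnected ⟨a, by simpa using hAxa.ne'⟩ ⟨b, by simpa using hAxb.ne'⟩).some
    refine ⟨p.map (Embedding.induce _).toHom, fun hx => ?_⟩
    replace hx : x ∈ (p.map (Embedding.induce _).toHom).support := hx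
    rw [Walk.support_map, List.mem_map] at hx
    obtain ⟨y, -, hy⟩ := hx
    exact y.2 (by simpa using hy)
  have hpx : ∀ y, s(x, y) ∉ p.edges := fun y hy => hp (p.fst_mem_support_of_mem_edges hy)
  let c : G.Walk b b := .cons hAxb.symm (.cons hAxa p)
  have hc : c.edgeVector ∈ cycleSpace G.edgeFinset :=
    c.edgeVector_mem_cycleSpace fun e he => mem_edgeFinset.2 (c.edges_subset_edgeSet he)
  have hcv : ∀ y, c.edgeVector s(x, y) = (if y = b then 1 else 0) + (if y = a then 1 else 0) := by
    intro y
    simp [c, Walk.edgeVector_cons, Walk.edgeVector_eq_zero (hpx y), Pi.single_apply, hAxb.ne,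
      hAxa.ne]
  have hlt : (cycleSpace G.edgeFinset ⊓ supportedOn A) ⊔ (cycleSpace G.edgeFinset ⊓ supportedOn B) <
      cycleSpace G.edgeFinset := by
    refine lt_of_le_of_ne (sup_le inf_le_left inf_le_left) fun heq => ?_
    rw [← heq] at hc
    obtain ⟨u, ⟨huC, huA⟩, w, ⟨-, hwB⟩, huw⟩ := Submodule.mem_sup.1 hc
    have h := (mem_cycleSpace.1 huC).2 (Pi.single x 1)
    rw [Finset.sum_eq_single s(x, a)] at h
    · have h1 := congrFun huw s(x, a)
      rw [hcv, Pi.add_apply, hwB _ (hd hxa)] at h1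
      simp [hab] at h1
      simp [coboundary_mk, h1, hAxa.ne'] at h
    · intro e _ hne
      by_cases hx : x ∈ e
      · obtain ⟨y, rfl⟩ := hx
        suffices u s(x, y) = 0 by rw [this, zero_mul]
        by_cases hy : s(x, y) ∈ A
        · have h1 := congrFun huw s(x, y)
          rw [hcv, Pi.add_apply, hwB _ (hd hy), if_neg, if_neg] at h1
          · simpa using h1
          · rintro rfl; exact hne rfl
          · rintro rfl; exact hd hy hxb
        · exact huA _ hy
      · induction e with
        | _ r s =>
        simp only [Sym2.mem_iff, not_or] at hx
        simp [coboundary_mk, Ne.symm hx.1, Ne.symm hx.2]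
    · simp
  have h1 := Submodule.finrank_lt_finrank_of_lt hlt
  have h2 := Submodule.finrank_sup_add_finrank_inf_eq (cycleSpace G.edgeFinset ⊓ supportedOn A)
    (cycleSpace G.edgeFinset ⊓ supportedOn B)
  have h3 : (cycleSpace G.edgeFinset ⊓ supportedOn A) ⊓
      (cycleSpace G.edgeFinset ⊓ supportedOn B) = ⊥ := by
    rw [eq_bot_iff]
    rintro v ⟨⟨-, hvA⟩, -, hvB⟩
    refine funext fun e => ?_
    by_cases he : e ∈ A
    exacts [hvB e (hd he), hvA e he]
  rw [h3, finrank_bot] at h2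
  unfold subcodeRank
  omega

end

/-- Every 2-connected graph with `n` vertices and `m` edges contains at
least `binom(m - n + 2, 2)` distinct cycles. -/
theorem stmt2 [Fintype V] {G : SimpleGraph V} (hG : IsKConnected 2 G) :
    (G.edgeSet.ncard - Fintype.card V + 2).choose 2 ≤
      {H : G.Subgraph | IsCycleSubgraph H}.ncard := by
  classical
  have hind := hG.isIndecomposable_cycleSpace
  refine le_trans ?_ (hind.choose_le_ncard_isCircuit.trans ncard_isCircuit_cycleSpace_le)
  have := hG.connected.nonempty
  have hcard : G.edgeSet.ncard = G.edgeFinset.card := by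
    rw [← coe_edgeFinset, Set.ncard_coe_finset]
  have hdim := card_add_one_le_finrank_cycleSpace G.edgeFinset
  have hpos : 0 < Module.finrank (ZMod 2) (cycleSpace G.edgeFinset) := by
    have hconn := hG.connected.card_vert_le_card_edgeSet_add_one
    rw [Nat.card_coe_set_eq, hcard, Nat.card_eq_fintype_card] at hconn
    have hone : 1 < G.edgeFinset.card := by
      have := hG.1
      omega
    obtain ⟨e, he, f, hf, hef⟩ := Finset.one_lt_card.1 hone
    exact (Nat.zero_le _).trans_lt (hind.rank_add_lt {e} (G.edgeFinset.erase e)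
      (by rw [← Finset.insert_eq, Finset.insert_erase he]) (by simp) (by simp)
      ⟨f, Finset.mem_erase.2 ⟨hef.symm, hf⟩⟩)
  exact Nat.choose_le_choose 2 (by omega)
end
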